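/- There is no finite Frobenius group with perfect order classes whose Frobenius complement H is soluble, not nilpotent, has every prime divisor of |H| among {2,3,5}, and has order divisible by both 3 and 5. -/

import Mathlib

/-- The number of elements of order `n` in the group `G`. -/
noncomputable def orderCount (G : Type*) [Group G] (n : ℕ) : ℕ :=
  Nat.card {g : G // orderOf g = n}

/-- A group has *perfect order classes* if, for every positive integer `n`, the number of
elements of order `n` is either zero or a divisor of the order of the group. -/
def PerfectOrderClasses (G : Type*) [Group G] : Prop :=
  ∀ n : ℕ, 0 < n → orderCount G n = 0 ∨ orderCount G n ∣ Nat.card G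

/-- `G` is a Frobenius group with Frobenius kernel `K` and Frobenius complement `H`:
`K` is a nontrivial proper normal subgroup, `H` a subgroup with `K ⊓ H = ⊥` and `KH = G`,
and the conjugation action of `H` on `K` is fixed-point-free. -/
def IsFrobeniusWith {G : Type*} [Group G] (K H : Subgroup G) : Prop :=
  K ≠ ⊥ ∧ K ≠ ⊤ ∧ K.Normal ∧ K ⊓ H = ⊥ ∧
    (∀ g : G, ∃ k ∈ K, ∃ h ∈ H, g = k * h) ∧
    ∀ h ∈ H, h ≠ 1 → ∀ k ∈ K, k ≠ 1 → h * k * h⁻¹ ≠ k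

/-- For odd `q > 1` and an odd prime `l`, some prime other than `2`, `3`, `5` divides
`q ^ l - 1`. -/
theorem not_smooth_pow_odd_prime_sub_one {q l : ℕ} (hq : Odd q) (hq1 : 1 < q) (hl : l.Prime)
    (hl2 : Odd l) : ¬ ∀ r : ℕ, r.Prime → r ∣ q ^ l - 1 → r = 2 ∨ r = 3 ∨ r = 5 := by
  intro hsm
  set S := ∑ i ∈ Finset.range l, q ^ i with hS
  have hSdvd : S ∣ q ^ l - 1 := ⟨q - 1, by
    have := Nat.geomSum_eq hq1 l
    rw [hS, this, Nat.div_mul_cancel]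
    simpa using Nat.sub_dvd_pow_sub_pow q 1 l⟩
  have hSodd : Odd S := by
    rw [hS, Finset.odd_sum_iff_odd_card_odd]
    simpa [hq.pow] using hl2
  have hlS : l < S := by
    rw [hS]
    calc l = ∑ i ∈ Finset.range l, 1 := by simp
      _ < _ := by
        refine Finset.sum_lt_sum (fun i _ => Nat.one_le_pow _ _ (by omega)) ⟨1, ?_, by simpa⟩
        simpa using hl.one_lt
  have key : ∀ r : ℕ, r.Prime → r ∣ S → r = l ∧ (r = 3 ∨ r = 5) := by
    intro r hr hrS
    have h35 : r = 3 ∨ r = 5 := by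
      rcases hsm r hr (hrS.trans hSdvd) with rfl | h | h
      · exact absurd (even_iff_two_dvd.2 hrS) (Nat.not_even_iff_odd.2 hSodd)
      · exact Or.inl h
      · exact Or.inr h
    refine ⟨?_, h35⟩
    have := Fact.mk hr
    have h1 : (q : ZMod r) ^ l = 1 := by
      have := (ZMod.natCast_eq_zero_iff (q ^ l - 1) r).2 (hrS.trans hSdvd)
      rw [Nat.cast_sub (Nat.one_le_pow _ _ (by omega))] at this
      push_cast at this
      exact sub_eq_zero.1 this
    have hq0 : (q : ZMod r) ≠ 0 := by
      intro h
      rw [h, zero_pow hl.ne_zero] at h1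
      exact zero_ne_one h1
    have h2 : (q : ZMod r) ^ 4 = 1 := by
      have := ZMod.pow_card_sub_one_eq_one hq0
      rcases h35 with rfl | rfl
      · rw [show 4 = (3 - 1) * 2 from rfl, pow_mul, this, one_pow]
      · exact this
    have h3 : (q : ZMod r) = 1 := by
      rw [← orderOf_eq_one_iff]
      have hc : Nat.Coprime l 4 := by
        have : Nat.Coprime l (2 ^ 2) := (Nat.Coprime.pow_right 2 (Nat.coprime_two_right.2 hl2))
        simpa using this
      exact Nat.eq_one_of_dvd_coprimes hc (orderOf_dvd_of_pow_eq_one h1)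
        (orderOf_dvd_of_pow_eq_one h2)
    have h4 : (l : ZMod r) = 0 := by
      have : ((S : ℕ) : ZMod r) = 0 := (ZMod.natCast_eq_zero_iff _ _).2 hrS
      rw [hS] at this
      push_cast at this
      simpa [h3] using this
    exact ((Nat.prime_dvd_prime_iff_eq hr hl).1 ((ZMod.natCast_eq_zero_iff _ _).1 h4))
  have hS1 : S ≠ 1 := by have := hl.one_lt; omega
  have hS0 : S ≠ 0 := by omega
  have hl35 : l = 3 ∨ l = 5 := by
    obtain ⟨r, hr, hrS⟩ := Nat.exists_prime_and_dvd hS1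
    obtain ⟨rfl, h⟩ := key r hr hrS
    exact h
  have hpow := Nat.eq_prime_pow_of_unique_prime_dvd hS0 (fun {d} hd hdS => (key d hd hdS).1)
  set s := S.primeFactorsList.length
  have hs2 : 2 ≤ s := by
    by_contra h
    have h1 : l ^ s ≤ l ^ 1 := Nat.pow_le_pow_right hl.pos (by omega)
    rw [← hpow, pow_one] at h1
    omega
  have hll : l ^ 2 ∣ S := by rw [hpow]; exact pow_dvd_pow _ hs2
  rcases hl35 with rfl | rfl
  · have h : ((S : ℕ) : ZMod 9) = 0 := (ZMod.natCast_eq_zero_iff _ _).2 hll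
    rw [hS] at h
    push_cast [Finset.sum_range_succ] at h
    generalize (q : ZMod 9) = x at h
    revert x
    decide
  · have h : ((S : ℕ) : ZMod 25) = 0 := (ZMod.natCast_eq_zero_iff _ _).2 hll
    rw [hS] at h
    push_cast [Finset.sum_range_succ] at h
    generalize (q : ZMod 25) = x at h
    revert x
    decide

/-- If `q ^ k - 1` has only the prime divisors `2`, `3`, `5`, for some odd `q > 1`, then
`k ≤ 2` or `4 ∣ k`. -/
theorem exponent_of_smooth {q k : ℕ} (hq : Odd q) (hq1 : 1 < q) (hk : 0 < k)
    (hsm : ∀ r : ℕ, r.Prime → r ∣ q ^ k - 1 → r = 2 ∨ r = 3 ∨ r = 5) :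
    k = 1 ∨ k = 2 ∨ 4 ∣ k := by
  obtain ⟨m, rfl⟩ | ⟨l, hl, ⟨m, rfl⟩, hodd⟩ := Nat.eq_two_pow_or_exists_odd_prime_and_dvd k
  · rcases m with _ | _ | m
    · simp
    · simp
    · exact Or.inr (Or.inr ⟨2 ^ m, by ring⟩)
  · refine absurd ?_ (not_smooth_pow_odd_prime_sub_one (q := q ^ m) hq.pow
      (Nat.one_lt_pow (by rintro rfl; simp at hk) hq1) hl hodd)
    rwa [← pow_mul, mul_comm m]

/-- The only `q` coprime to `30` for which `q ^ 4 - 1` has no prime divisors other than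
`2`, `3`, `5` is `7`. -/
theorem eq_seven_of_smooth_pow_four {q : ℕ} (hq : Odd q) (hq1 : 1 < q) (h3 : ¬ 3 ∣ q)
    (hsm : ∀ r : ℕ, r.Prime → r ∣ q ^ 4 - 1 → r = 2 ∨ r = 3 ∨ r = 5) : q = 7 := by
  obtain ⟨t, rfl⟩ := hq
  set m := 2 * t ^ 2 + 2 * t + 1 with hm
  have hq4 : (2 * t + 1) ^ 4 - 1 = 2 * m * (4 * t * (t + 1)) := by
    rw [Nat.sub_eq_iff_eq_add (Nat.one_le_pow _ _ (by omega)), hm]; ring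
  have key : ∀ r : ℕ, r.Prime → r ∣ m → r = 5 := by
    intro r hr hrm
    rcases hsm r hr (hq4 ▸ (hrm.mul_left 2).mul_right _) with rfl | rfl | h
    · omega
    · exfalso
      have h : ((m : ℕ) : ZMod 3) = 0 := (ZMod.natCast_eq_zero_iff _ _).2 hrm
      rw [hm] at h
      push_cast at h
      generalize (t : ZMod 3) = x at h
      revert x
      decide
    · exact h
  have hpow := Nat.eq_prime_pow_of_unique_prime_dvd (n := m) (p := 5) (by omega)
    (fun {d} hd hdm => key d hd hdm)
  set c := m.primeFactorsList.length
  have hc0 : 0 < c := by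
    rcases Nat.eq_zero_or_pos c with h | h
    · rw [h, pow_zero] at hpow
      have : t = 0 := by nlinarith
      omega
    · exact h
  have h5 : 5 ^ c - 1 ∣ (2 * t + 1) ^ 4 - 1 := by
    rw [← hpow, hq4]
    exact ⟨2 * m * 2, by rw [hm]; simp only [Nat.add_sub_cancel]; ring⟩
  have hsm5 : ∀ r : ℕ, r.Prime → r ∣ 5 ^ c - 1 → r = 2 ∨ r = 3 ∨ r = 5 :=
    fun r hr h => hsm r hr (h.trans h5)
  rcases exponent_of_smooth (by decide) (by norm_num) hc0 hsm5 with h | h | ⟨d, hd⟩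
  · rw [h] at hpow
    have : t = 1 := by nlinarith
    subst this
    norm_num at h3
  · rw [h] at hpow
    have : t = 3 := by nlinarith
    omega
  · exfalso
    have h13 : 13 ∣ 5 ^ c - 1 := by
      have h := Nat.sub_dvd_pow_sub_pow (5 ^ 4) 1 d
      rw [one_pow, ← pow_mul, ← hd] at h
      exact (show 13 ∣ 5 ^ 4 - 1 by norm_num).trans h
    have := hsm5 13 (by norm_num) h13
    omega

/-- The prime powers `p ^ k` for which `p ^ k - 1` is divisible by `6` and by no primes other
than `2`, `3`, `5` have `k ≤ 2`, apart from `7 ^ 4`. -/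
theorem smooth_prime_pow_sub_one {p k : ℕ} (hp : p.Prime) (hk : 0 < k) (h2 : 2 ∣ p ^ k - 1)
    (h3 : 3 ∣ p ^ k - 1)
    (hsm : ∀ r : ℕ, r.Prime → r ∣ p ^ k - 1 → r = 2 ∨ r = 3 ∨ r = 5) :
    k = 1 ∨ k = 2 ∨ (p = 7 ∧ k = 4) := by
  have hnd : ∀ r : ℕ, r.Prime → r ∣ p ^ k - 1 → ¬ r ∣ p := by
    intro r hr h hrp
    have h1 : r ∣ p ^ k := hrp.trans (dvd_pow_self p hk.ne')
    have := (Nat.dvd_sub_iff_right (Nat.one_le_pow _ _ hp.pos) h1).1 h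
    exact hr.one_lt.ne' (Nat.dvd_one.1 this)
  have hodd : Odd p := by
    rw [← Nat.not_even_iff_odd, even_iff_two_dvd]
    exact hnd 2 Nat.prime_two h2
  rcases exponent_of_smooth hodd hp.one_lt hk hsm with h | h | ⟨m, rfl⟩
  · exact Or.inl h
  · exact Or.inr (Or.inl h)
  · have hm : m ≠ 0 := by omega
    have h7 : p ^ m = 7 := by
      refine eq_seven_of_smooth_pow_four hodd.pow (Nat.one_lt_pow hm hp.one_lt) ?_ ?_
      · exact fun h => hnd 3 Nat.prime_three h3 (Nat.prime_three.dvd_of_dvd_pow h)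
      · rwa [← pow_mul, mul_comm m]
    obtain ⟨rfl, rfl⟩ : p = 7 ∧ m = 1 := by
      have := (Nat.Prime.pow_eq_iff (by norm_num : Nat.Prime 7)).1 h7
      exact this
    exact Or.inr (Or.inr ⟨rfl, rfl⟩)

/-- The order of a finite group acting freely on a set divides the cardinality of the set. -/
theorem card_dvd_card_of_free {G X : Type*} [Group G] [MulAction G X]
    (hfree : ∀ (g : G) (x : X), g • x = x → g = 1) : Nat.card G ∣ Nat.card X := by
  have e := MulAction.selfEquivOrbitsQuotientProd (G := G) (X := X)
    (fun b => (Subgroup.eq_bot_iff_forall _).2 fun g hg => hfree g b hg)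
  rw [Nat.card_congr e, Nat.card_prod]
  exact Dvd.intro_left _ rfl

/-- The number of elements of order `n` is divisible by `φ n`. -/
theorem totient_dvd_orderCount (G : Type*) [Group G] {n : ℕ} (hn : 0 < n) :
    n.totient ∣ orderCount G n := by
  have : NeZero n := ⟨hn.ne'⟩
  let act : MulAction (ZMod n)ˣ {g : G // orderOf g = n} :=
    { smul := fun u g => ⟨g.1 ^ (u : ZMod n).val, by
        rw [Nat.Coprime.orderOf_pow, g.2]
        rw [g.2]
        exact (ZMod.val_coe_unit_coprime u).symm⟩
      one_smul := fun g => Subtype.ext <| by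
        change g.1 ^ ((1 : (ZMod n)ˣ) : ZMod n).val = g.1
        conv_rhs => rw [← pow_one g.1]
        rw [pow_eq_pow_iff_modEq, g.2, ← ZMod.natCast_eq_natCast_iff]
        simp
      mul_smul := fun u v g => Subtype.ext <| by
        change g.1 ^ ((u * v : (ZMod n)ˣ) : ZMod n).val
          = (g.1 ^ (v : ZMod n).val) ^ (u : ZMod n).val
        rw [← pow_mul, pow_eq_pow_iff_modEq, g.2, ← ZMod.natCast_eq_natCast_iff]
        simp [mul_comm] }
  have h := card_dvd_card_of_free (G := (ZMod n)ˣ) (X := {g : G // orderOf g = n}) (by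
    intro u g hug
    have h1 : g.1 ^ (u : ZMod n).val = g.1 ^ 1 := by
      rw [pow_one]; exact congrArg Subtype.val hug
    rw [pow_eq_pow_iff_modEq, g.2, ← ZMod.natCast_eq_natCast_iff] at h1
    ext
    simpa using h1)
  rwa [Nat.card_eq_fintype_card, ZMod.card_units_eq_totient] at h

/-- Elements whose order is a product of coprime `m` and `n` correspond to commuting pairs of
elements of orders `m` and `n`. -/
theorem orderCount_mul_of_coprime (G : Type*) [Group G] {m n : ℕ} (hm : 0 < m) (hn : 0 < n)
    (hmn : m.Coprime n) :
    orderCount G (m * n) =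
      Nat.card {x : G × G // orderOf x.1 = m ∧ orderOf x.2 = n ∧ Commute x.1 x.2} := by
  obtain ⟨e, he1, he2⟩ := Nat.chineseRemainder hmn 1 0
  obtain ⟨f, hf1, hf2⟩ := Nat.chineseRemainder hmn 0 1
  have pow_id : ∀ {g : G} {k a : ℕ}, orderOf g = k → a ≡ 1 [MOD k] → g ^ a = g := by
    intro g k a hg ha
    conv_rhs => rw [← pow_one g]
    rwa [pow_eq_pow_iff_modEq, hg]
  have pow_triv : ∀ {g : G} {k a : ℕ}, orderOf g = k → a ≡ 0 [MOD k] → g ^ a = 1 := by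
    intro g k a hg ha
    rw [← orderOf_dvd_iff_pow_eq_one, hg]
    exact (Nat.modEq_zero_iff_dvd).1 ha
  symm
  refine Nat.card_eq_of_bijective
    (fun x => ⟨x.1.1 * x.1.2, by
      obtain ⟨⟨x, y⟩, h1, h2, h3⟩ := x
      dsimp only at h1 h2 h3 ⊢
      rw [h3.orderOf_mul_eq_mul_orderOf_of_coprime (by rwa [h1, h2]), h1, h2]⟩) ⟨?_, ?_⟩
  · rintro ⟨⟨x, y⟩, h1, h2, h3⟩ ⟨⟨x', y'⟩, h1', h2', h3'⟩ h
    have h : x * y = x' * y' := congrArg Subtype.val h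
    dsimp only at h1 h2 h3 h1' h2' h3'
    have hx : x = x' := by
      have := congrArg (· ^ e) h
      simpa [h3.mul_pow, h3'.mul_pow, pow_id h1 he1, pow_id h1' he1, pow_triv h2 he2,
        pow_triv h2' he2] using this
    subst hx
    have hy : y = y' := mul_left_cancel h
    subst hy
    rfl
  · rintro ⟨g, hg⟩
    have hef : g ^ e * g ^ f = g := by
      rw [← pow_add]
      refine pow_id hg ?_
      rw [← Nat.modEq_and_modEq_iff_modEq_mul hmn]
      exact ⟨by simpa using he1.add hf1, by simpa using he2.add hf2⟩
    have hc : Commute (g ^ e) (g ^ f) := (Commute.refl g).pow_pow e f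
    have d1 : orderOf (g ^ e) ∣ m := by
      rw [orderOf_dvd_iff_pow_eq_one, ← pow_mul, ← orderOf_dvd_iff_pow_eq_one, hg, mul_comm e]
      exact mul_dvd_mul_left m ((Nat.modEq_zero_iff_dvd).1 he2)
    have d2 : orderOf (g ^ f) ∣ n := by
      rw [orderOf_dvd_iff_pow_eq_one, ← pow_mul, ← orderOf_dvd_iff_pow_eq_one, hg]
      exact mul_dvd_mul_right ((Nat.modEq_zero_iff_dvd).1 hf1) n
    have hprod : orderOf (g ^ e) * orderOf (g ^ f) = m * n := by
      rw [← hc.orderOf_mul_eq_mul_orderOf_of_coprime (hmn.of_dvd d1 d2), hef, hg]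
    have p1 := Nat.le_of_dvd hm d1
    have p2 := Nat.le_of_dvd hn d2
    have q1 : orderOf (g ^ e) = m := by nlinarith
    have q2 : orderOf (g ^ f) = n := by nlinarith
    exact ⟨⟨(g ^ e, g ^ f), q1, q2, hc⟩, Subtype.ext hef⟩

theorem PerfectOrderClasses.orderCount_dvd {G : Type*} [Group G] [Finite G]
    (h : PerfectOrderClasses G) (g : G) : orderCount G (orderOf g) ∣ Nat.card G := by
  refine (h (orderOf g) (orderOf_pos g)).resolve_left ?_
  have : Nonempty {x : G // orderOf x = orderOf g} := ⟨⟨g, rfl⟩⟩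
  exact Nat.card_pos.ne'

/-- In a finite group with perfect order classes, `φ (orderOf g)` divides the group order. -/
theorem PerfectOrderClasses.totient_dvd {G : Type*} [Group G] [Finite G]
    (h : PerfectOrderClasses G) (g : G) : (orderOf g).totient ∣ Nat.card G :=
  (totient_dvd_orderCount G (orderOf_pos g)).trans (h.orderCount_dvd g)

theorem PerfectOrderClasses.totient_card_dvd {G : Type*} [Group G] [Finite G]
    (h : PerfectOrderClasses G) (C : Subgroup G) [IsCyclic C] :
    (Nat.card C).totient ∣ Nat.card G := by
  obtain ⟨g, hg⟩ := IsCyclic.exists_generator (α := C)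
  have := h.totient_dvd (g : G)
  rwa [Subgroup.orderOf_coe, orderOf_eq_card_of_forall_mem_zpowers hg] at this

theorem totient_of_smooth {n : ℕ} (hn : 0 < n) (h2 : 2 ∣ n) (h3 : 3 ∣ n) (h5 : 5 ∣ n)
    (hsm : ∀ r : ℕ, r.Prime → r ∣ n → r = 2 ∨ r = 3 ∨ r = 5) : n.totient * 30 = n * 8 := by
  have hpf : n.primeFactors = {2, 3, 5} := by
    ext r
    simp only [Nat.mem_primeFactors, Finset.mem_insert, Finset.mem_singleton]
    constructor
    · rintro ⟨h, h', -⟩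
      exact hsm r h h'
    · rintro (rfl | rfl | rfl)
      · exact ⟨by norm_num, h2, hn.ne'⟩
      · exact ⟨by norm_num, h3, hn.ne'⟩
      · exact ⟨by norm_num, h5, hn.ne'⟩
  have := Nat.totient_mul_prod_primeFactors n
  rw [hpf] at this
  simpa using this

/-- In a finite soluble group, between normal subgroups `A < C` there is a normal subgroup
`B` of `G` such that `B / A` is a nontrivial elementary abelian `r`-group. -/
theorem exists_normal_elementary_section {G : Type*} [Group G] [Finite G] [Group.IsSolvable G]
    {A C : Subgroup G} [hA : A.Normal] [hC : C.Normal] (hAC : A < C) :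
    ∃ (B : Subgroup G) (r : ℕ), B.Normal ∧ A < B ∧ B ≤ C ∧ r.Prime ∧
      (∀ b ∈ B, ∀ c ∈ B, b * c * b⁻¹ * c⁻¹ ∈ A) ∧ ∀ b ∈ B, b ^ r ∈ A := by
  let S : Set (Subgroup (G ⧸ A)) := {N | N.Normal ∧ N ≠ ⊥ ∧ N ≤ C.map (QuotientGroup.mk' A)}
  have hne : S.Nonempty := by
    refine ⟨C.map (QuotientGroup.mk' A), hC.map _ (QuotientGroup.mk'_surjective A), ?_, le_rfl⟩
    rw [Ne, Subgroup.map_eq_bot_iff, QuotientGroup.ker_mk']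
    exact not_le_of_gt hAC
  obtain ⟨N, hN⟩ := S.toFinite.exists_minimal hne
  obtain ⟨⟨hNn, hNb, hNC⟩, hmin⟩ := hN
  have hcomm : ⁅N, N⁆ = ⊥ := by
    by_contra h
    have hlt := Group.IsSolvable.commutator_lt_of_ne_bot hNb
    exact not_le_of_gt hlt (hmin ⟨inferInstance, h, hlt.le.trans hNC⟩ hlt.le)
  have hNcomm : ∀ a ∈ N, ∀ b ∈ N, a * b = b * a := fun a ha b hb => by
    have := Subgroup.commutator_eq_bot_iff_le_centralizer.1 hcomm ha
    exact ((Subgroup.mem_centralizer_iff.1 this) b hb).symm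
  have hcard : Nat.card N ≠ 1 := by rwa [Ne, Subgroup.card_eq_one]
  obtain ⟨r, hr, hrN⟩ := Nat.exists_prime_and_dvd hcard
  let M : Subgroup (G ⧸ A) :=
    { carrier := {x | x ∈ N ∧ x ^ r = 1}
      one_mem' := ⟨N.one_mem, one_pow r⟩
      mul_mem' := by
        rintro a b ⟨ha, ha'⟩ ⟨hb, hb'⟩
        exact ⟨N.mul_mem ha hb, by rw [Commute.mul_pow (hNcomm a ha b hb), ha', hb', one_mul]⟩
      inv_mem' := by
        rintro a ⟨ha, ha'⟩
        exact ⟨N.inv_mem ha, by rw [inv_pow, ha', inv_one]⟩ }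
  have hMN : M ≤ N := fun x hx => hx.1
  have hM : M.Normal := ⟨by
    rintro x ⟨hx, hx'⟩ g
    exact ⟨hNn.conj_mem x hx g, by rw [conj_pow, hx']; simp⟩⟩
  have hMb : M ≠ ⊥ := by
    have := Fact.mk hr
    obtain ⟨x, hx⟩ := exists_prime_orderOf_dvd_card' r hrN
    intro h
    have hxM : (x : G ⧸ A) ∈ M := ⟨x.2, by
      rw [← hx, ← Subgroup.orderOf_coe]; exact pow_orderOf_eq_one _⟩
    rw [h, Subgroup.mem_bot] at hxM
    have : x = 1 := Subtype.ext hxM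
    rw [this, orderOf_one] at hx
    exact hr.one_lt.ne hx
  have hNM : N ≤ M := hmin ⟨hM, hMb, hMN.trans hNC⟩ hMN
  refine ⟨N.comap (QuotientGroup.mk' A), r, inferInstance, ?_, ?_, hr, ?_, ?_⟩
  · refine lt_of_le_of_ne ?_ ?_
    · intro a ha
      rw [Subgroup.mem_comap, QuotientGroup.mk'_apply, (QuotientGroup.eq_one_iff a).2 ha]
      exact N.one_mem
    · intro h
      apply hNb
      rw [← Subgroup.map_comap_eq_self_of_surjective (QuotientGroup.mk'_surjective A) N, ← h]
      exact QuotientGroup.map_mk'_self A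
  · intro b hb
    obtain ⟨c, hc, hcb⟩ := hNC hb
    have : c⁻¹ * b ∈ A := QuotientGroup.eq.1 hcb
    have := C.mul_mem hc (hAC.le this)
    simpa using this
  · intro b hb c hc
    rw [← QuotientGroup.eq_one_iff]
    have := hNcomm _ hb _ hc
    simp only [QuotientGroup.mk'_apply] at this
    simp [this]
  · intro b hb
    rw [← QuotientGroup.eq_one_iff]
    exact (hNM hb).2

section FreeLinearAction

variable {p : ℕ} [Fact p.Prime] {V : Type*} [AddCommGroup V] [Module (ZMod p) V]
  {H : Type*} [Group H] {ρ : H →* Module.End (ZMod p) V}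

theorem eq_of_apply_eq_of_free (hfree : ∀ h v, v ≠ 0 → ρ h v = v → h = 1) {g h : H} {v : V}
    (hv : v ≠ 0) (hgh : ρ g v = ρ h v) : g = h := by
  have : ρ (h⁻¹ * g) v = v := by
    rw [map_mul, Module.End.mul_apply, hgh, ← Module.End.mul_apply, ← map_mul]
    simp
  exact (inv_mul_eq_one.1 (hfree _ v hv this)).symm

theorem injective_of_free [Nontrivial V] (hfree : ∀ h v, v ≠ 0 → ρ h v = v → h = 1) :
    Function.Injective ρ := by
  obtain ⟨v, hv⟩ := exists_ne (0 : V)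
  exact fun g h hgh => eq_of_apply_eq_of_free hfree hv (by rw [hgh])

/-- An involution acting freely acts as `-1`. -/
theorem apply_eq_neg_of_sq_eq_one (hfree : ∀ h v, v ≠ 0 → ρ h v = v → h = 1) {t : H}
    (ht : t ^ 2 = 1) (ht1 : t ≠ 1) : ρ t = -1 := by
  ext v
  have h : ρ t (v + ρ t v) = v + ρ t v := by
    rw [map_add, ← Module.End.mul_apply, ← map_mul, ← sq, ht, map_one, Module.End.one_apply,
      add_comm]
  by_contra hne
  refine ht1 (hfree t _ (fun h0 => hne ?_) h)
  simpa using (neg_eq_of_add_eq_zero_right h0).symm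

theorem eq_of_sq_eq_one [Nontrivial V] (hfree : ∀ h v, v ≠ 0 → ρ h v = v → h = 1) {s t : H}
    (hs : s ^ 2 = 1) (hs1 : s ≠ 1) (ht : t ^ 2 = 1) (ht1 : t ≠ 1) : s = t :=
  injective_of_free hfree (by
    rw [apply_eq_neg_of_sq_eq_one hfree hs hs1, apply_eq_neg_of_sq_eq_one hfree ht ht1])

/-- If `V` is generated by a single vector under the powers of `x`, the centralizer of `x` is
commutative. -/
theorem commute_of_span_pow_eq_top [Nontrivial V]
    (hfree : ∀ h v, v ≠ 0 → ρ h v = v → h = 1) {x : H} {v : V}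
    (hv : Submodule.span (ZMod p) (Set.range fun i : ℕ => ρ (x ^ i) v) = ⊤) {y z : H}
    (hy : Commute x y) (hz : Commute x z) : Commute y z := by
  have hgen : ∀ s : V, ∃ e ∈ Algebra.adjoin (ZMod p) {ρ x}, e v = s := by
    intro s
    have hs : s ∈ Submodule.span (ZMod p) (Set.range fun i : ℕ => ρ (x ^ i) v) := hv ▸ trivial
    induction hs using Submodule.span_induction with
    | mem u hu =>
      obtain ⟨i, rfl⟩ := hu
      exact ⟨ρ x ^ i, pow_mem (Algebra.self_mem_adjoin_singleton _ _) i, by rw [← map_pow]⟩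
    | zero => exact ⟨0, zero_mem _, rfl⟩
    | add a b _ _ ha hb =>
      obtain ⟨e, he, rfl⟩ := ha
      obtain ⟨f, hf, rfl⟩ := hb
      exact ⟨e + f, add_mem he hf, rfl⟩
    | smul c a _ ha =>
      obtain ⟨e, he, rfl⟩ := ha
      exact ⟨c • e, Subalgebra.smul_mem _ he c, rfl⟩
  have hcomm : ∀ w : H, Commute x w → ∀ e ∈ Algebra.adjoin (ZMod p) {ρ x}, Commute (ρ w) e :=
    fun w hw e he => Algebra.commute_of_mem_adjoin_singleton_of_commute he (hw.symm.map ρ)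
  obtain ⟨e, he, hev⟩ := hgen (ρ y v)
  have hye : ρ y = e := by
    ext u
    obtain ⟨f, hf, rfl⟩ := hgen u
    have h1 : e * f = f * e :=
      Algebra.commute_of_mem_adjoin_singleton_of_commute hf
        (Algebra.commute_of_mem_adjoin_self he).symm
    rw [← Module.End.mul_apply, (hcomm y hy f hf).eq, ← Module.End.mul_apply, h1,
      Module.End.mul_apply, Module.End.mul_apply, hev]
  apply injective_of_free hfree
  rw [map_mul, map_mul, hye, (hcomm z hz e he).eq]

open scoped IsMulCommutative in
/-- A finite commutative group acting faithfully and generating a domain is cyclic. -/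
theorem isCyclic_of_injective_adjoin [Finite V] [Nontrivial V] [Finite H]
    (hfree : ∀ h v, v ≠ 0 → ρ h v = v → h = 1) {A : Subgroup H}
    (hA : ∀ a ∈ A, ∀ b ∈ A, a * b = b * a)
    (hinj : ∀ e ∈ Algebra.adjoin (ZMod p) (ρ '' (A : Set H)), e ≠ 0 → ∀ v, e v = 0 → v = 0) :
    IsCyclic A := by
  have hcomm : IsMulCommutative (Algebra.adjoin (ZMod p) (ρ '' (A : Set H))) :=
    Algebra.isMulCommutative_adjoin (ZMod p) (by
      rintro _ ⟨a, ha, rfl⟩ _ ⟨b, hb, rfl⟩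
      rw [← map_mul, hA a ha b hb, map_mul])
  have hnz : NoZeroDivisors (Algebra.adjoin (ZMod p) (ρ '' (A : Set H))) := ⟨by
    rintro ⟨e, he⟩ ⟨f, hf⟩ hef
    have hef : e * f = 0 := congrArg Subtype.val hef
    by_cases he0 : e = 0
    · exact Or.inl (Subtype.ext he0)
    · refine Or.inr (Subtype.ext (LinearMap.ext fun v => hinj e he he0 _ ?_))
      rw [← Module.End.mul_apply, hef, LinearMap.zero_apply]⟩
  have : IsDomain (Algebra.adjoin (ZMod p) (ρ '' (A : Set H))) := NoZeroDivisors.to_isDomain _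
  let f : A →* Algebra.adjoin (ZMod p) (ρ '' (A : Set H)) :=
    { toFun := fun a => ⟨ρ a, Algebra.subset_adjoin ⟨a, a.2, rfl⟩⟩
      map_one' := Subtype.ext (map_one ρ)
      map_mul' := fun a b => Subtype.ext (map_mul ρ (a : H) (b : H)) }
  exact isCyclic_of_injective_ringHom f fun a b hab =>
    Subtype.ext (injective_of_free hfree (congrArg Subtype.val hab))

theorem conj_mem_adjoin {A : Subgroup H} [hAn : A.Normal] (h : H) {e : Module.End (ZMod p) V}
    (he : e ∈ Algebra.adjoin (ZMod p) (ρ '' (A : Set H))) :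
    ρ h * e * ρ h⁻¹ ∈ Algebra.adjoin (ZMod p) (ρ '' (A : Set H)) := by
  have h1 : ρ h⁻¹ * ρ h = 1 := by rw [← map_mul]; simp
  have h2 : ρ h * ρ h⁻¹ = 1 := by rw [← map_mul]; simp
  induction he using Algebra.adjoin_induction with
  | mem x hx =>
    obtain ⟨a, ha, rfl⟩ := hx
    refine Algebra.subset_adjoin ⟨h * a * h⁻¹, hAn.conj_mem a ha h, by simp⟩
  | algebraMap r =>
    rw [← Algebra.commutes, mul_assoc, h2, mul_one]
    exact Subalgebra.algebraMap_mem _ r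
  | add x y _ _ hx hy =>
    rw [mul_add, add_mul]
    exact add_mem hx hy
  | mul x y _ _ hx hy =>
    have : ρ h * (x * y) * ρ h⁻¹ = (ρ h * x * ρ h⁻¹) * (ρ h * y * ρ h⁻¹) := by
      simp only [mul_assoc]
      rw [← mul_assoc (ρ h⁻¹) (ρ h), h1, one_mul]
    rw [this]
    exact mul_mem hx hy

/-- If `H` is transitive on nonzero vectors, the algebra generated by a commutative normal
subgroup has no singular elements other than `0`. -/
theorem injective_adjoin_of_transitive [Finite V]
    (htrans : ∀ u v : V, u ≠ 0 → v ≠ 0 → ∃ h, ρ h u = v) {A : Subgroup H} [hAn : A.Normal]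
    (hA : ∀ a ∈ A, ∀ b ∈ A, a * b = b * a) :
    ∀ e ∈ Algebra.adjoin (ZMod p) (ρ '' (A : Set H)), e ≠ 0 → ∀ v, e v = 0 → v = 0 := by
  set E := Algebra.adjoin (ZMod p) (ρ '' (A : Set H)) with hE
  have hcomm : ∀ e ∈ E, ∀ f ∈ E, e * f = f * e := by
    intro e he f hf
    refine Algebra.commute_of_mem_adjoin_of_forall_mem_commute hf ?_
    rintro _ ⟨a, ha, rfl⟩
    refine (Algebra.commute_of_mem_adjoin_of_forall_mem_commute he ?_).symm
    rintro _ ⟨b, hb, rfl⟩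
    exact (map_mul ρ a b).symm.trans ((congrArg ρ (hA a ha b hb)).trans (map_mul ρ b a))
  have : Finite (Module.End (ZMod p) V) := Finite.of_injective _ DFunLike.coe_injective
  let I : V → Set (Module.End (ZMod p) V) := fun v => {e | e ∈ E ∧ e v = 0}
  have hcard : ∀ u v : V, u ≠ 0 → v ≠ 0 → (I u).ncard ≤ (I v).ncard := by
    intro u v hu hv
    obtain ⟨h, rfl⟩ := htrans u v hu hv
    have h1 : ρ h⁻¹ * ρ h = 1 := by rw [← map_mul]; simp
    refine Set.ncard_le_ncard_of_injOn (fun e => ρ h * e * ρ h⁻¹) ?_ ?_ (Set.toFinite _)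
    · rintro e ⟨he, heu⟩
      refine ⟨conj_mem_adjoin h he, ?_⟩
      rw [← Module.End.mul_apply, mul_assoc, h1, mul_one, Module.End.mul_apply, heu, map_zero]
    · intro e _ f _ hef
      have h2 := congrArg (fun x => ρ h⁻¹ * x * ρ h) hef
      simpa only [mul_assoc, h1, mul_one, ← mul_assoc (ρ h⁻¹) (ρ h), one_mul] using h2
  have heq : ∀ u v : V, u ≠ 0 → v ≠ 0 → I u ⊆ I v → I u = I v := fun u v hu hv h =>
    Set.eq_of_subset_of_ncard_le h (hcard v u hv hu) (Set.toFinite _)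
  have hprime : ∀ u : V, ∀ e ∈ E, e u ≠ 0 → I u = I (e u) := by
    intro u e he heu
    have hu : u ≠ 0 := by rintro rfl; exact heu (map_zero e)
    refine heq u _ hu heu ?_
    rintro f ⟨hf, hfu⟩
    refine ⟨hf, ?_⟩
    rw [← Module.End.mul_apply, hcomm f hf e he, Module.End.mul_apply, hfu, map_zero]
  intro e he he0 u heu
  by_contra hu
  apply he0
  ext w
  by_contra hew
  have hw : w ≠ 0 := by rintro rfl; exact hew (by simp)
  have hew : e w ≠ 0 := hew
  have h1 : e (u + w) = e w := by rw [map_add, heu, zero_add]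
  have h2 : I (u + w) = I w := by
    rw [hprime (u + w) e he (by rwa [h1]), h1, ← hprime w e he hew]
  have h3 : I w = I u := by
    refine heq w u hw hu ?_
    rintro f ⟨hf, hfw⟩
    have : f ∈ I (u + w) := by rw [h2]; exact ⟨hf, hfw⟩
    refine ⟨hf, ?_⟩
    have h4 := this.2
    rwa [map_add, hfw, add_zero] at h4
  have : e ∈ I w := by rw [h3]; exact ⟨he, heu⟩
  exact hew this.2

end FreeLinearAction

section FreeLinearAction

variable {p : ℕ} [Fact p.Prime] {V : Type*} [AddCommGroup V] [Module (ZMod p) V]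
  {H : Type*} [Group H] {ρ : H →* Module.End (ZMod p) V}

open scoped IsMulCommutative in
/-- A finite commutative algebra of endomorphisms without singular nonzero elements is a field. -/
theorem exists_field_of_injective.{u} {V : Type u} [AddCommGroup V] [Module (ZMod p) V]
    [Finite V] [Nontrivial V]
    (E : Subalgebra (ZMod p) (Module.End (ZMod p) V)) [IsMulCommutative E]
    (hinj : ∀ e ∈ E, e ≠ 0 → ∀ v, e v = 0 → v = 0) :
    ∃ (F : Type u) (_ : Field F) (_ : Algebra (ZMod p) F)
      (φ : F →ₐ[ZMod p] Module.End (ZMod p) V), φ.range = E := by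
  classical
  have hnz : NoZeroDivisors E := ⟨by
    rintro ⟨e, he⟩ ⟨f, hf⟩ hef
    have hef : e * f = 0 := congrArg Subtype.val hef
    by_cases he0 : e = 0
    · exact Or.inl (Subtype.ext he0)
    · refine Or.inr (Subtype.ext (LinearMap.ext fun v => hinj e he he0 _ ?_))
      rw [← Module.End.mul_apply, hef, LinearMap.zero_apply]⟩
  have : IsDomain E := NoZeroDivisors.to_isDomain _
  have : Finite (Module.End (ZMod p) V) := Finite.of_injective _ DFunLike.coe_injective
  have : Fintype E := Fintype.ofFinite E
  exact ⟨E, Fintype.fieldOfDomain E, inferInstanceAs (Algebra (ZMod p) E), E.val, E.range_val⟩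

/-- Automorphisms of a finite extension of `ZMod p` are powers of Frobenius. -/
theorem exists_eq_pow_of_algEquiv {F : Type*} [Field F] [Finite F] [Algebra (ZMod p) F]
    (σ : F ≃ₐ[ZMod p] F) : ∃ i < Module.finrank (ZMod p) F, ∀ x, σ x = x ^ p ^ i := by
  obtain ⟨⟨i, hi⟩, hσ⟩ :=
    (FiniteField.bijective_frobeniusAlgEquivOfAlgebraic_pow (ZMod p) F).2 σ
  refine ⟨i, hi, fun x => ?_⟩
  rw [← hσ]
  change (FiniteField.frobeniusAlgEquivOfAlgebraic (ZMod p) F ^ i) x = _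
  rw [AlgEquiv.coe_pow, FiniteField.coe_frobeniusAlgEquivOfAlgebraic_iterate, ZMod.card]

theorem normal_commutative_structure [Finite V] [Nontrivial V]
    (hfree : ∀ h v, v ≠ 0 → ρ h v = v → h = 1)
    (htrans : ∀ u v : V, u ≠ 0 → v ≠ 0 → ∃ h, ρ h u = v) {A : Subgroup H} [hAn : A.Normal]
    (hA : ∀ a ∈ A, ∀ b ∈ A, a * b = b * a) :
    ∃ d, 0 < d ∧ d ∣ Module.finrank (ZMod p) V ∧ Nat.card A ∣ p ^ d - 1 ∧
      (∀ h, ∃ i < d, ∀ a ∈ A, h * a * h⁻¹ = a ^ p ^ i) ∧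
      (d = Module.finrank (ZMod p) V → ∀ x y, (∀ a ∈ A, Commute a x) → (∀ a ∈ A, Commute a y) →
        Commute x y) ∧
      (d = 1 → ∀ a ∈ A, ∃ c : ZMod p, ρ a = algebraMap _ _ c) := by
  have hcomm : IsMulCommutative (Algebra.adjoin (ZMod p) (ρ '' (A : Set H))) :=
    Algebra.isMulCommutative_adjoin _ (by
      rintro _ ⟨a, ha, rfl⟩ _ ⟨b, hb, rfl⟩
      rw [← map_mul, hA a ha b hb, map_mul])
  have hinj := injective_adjoin_of_transitive htrans hA
  obtain ⟨F, _, _, φ, hφ⟩ := exists_field_of_injective _ hinj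
  have hρ := injective_of_free hfree
  have : Finite (Module.End (ZMod p) V) := Finite.of_injective _ DFunLike.coe_injective
  have hφi : Function.Injective φ := φ.toRingHom.injective
  have : Finite F := Finite.of_injective _ hφi
  let _ : Module F V := Module.compHom V φ.toRingHom
  have hsmul : ∀ (x : F) (v : V), x • v = φ x v := fun _ _ => rfl
  have : IsScalarTower (ZMod p) F V := ⟨fun c x v => by
    rw [hsmul, hsmul, map_smul, LinearMap.smul_apply]⟩
  have hmem : ∀ a ∈ A, ∃ x, φ x = ρ a := fun a ha => by
    have : ρ a ∈ φ.range := hφ ▸ Algebra.subset_adjoin ⟨a, ha, rfl⟩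
    exact this
  choose! ψ hψ using hmem
  have hmul : Module.finrank (ZMod p) F * Module.finrank F V = Module.finrank (ZMod p) V :=
    Module.finrank_mul_finrank _ _ _
  have hcomφ : ∀ y, (∀ a ∈ A, Commute a y) → ∀ x, Commute (ρ y) (φ x) := by
    intro y hy x
    have : φ x ∈ Algebra.adjoin (ZMod p) (ρ '' (A : Set H)) := hφ ▸ ⟨x, rfl⟩
    refine Algebra.commute_of_mem_adjoin_of_forall_mem_commute this ?_
    rintro _ ⟨a, ha, rfl⟩
    exact (hy a ha).symm.map ρ
  refine ⟨Module.finrank (ZMod p) F, Module.finrank_pos, ⟨_, hmul.symm⟩, ?_, ?_, ?_, ?_⟩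
  · have hc : Nat.card F = p ^ Module.finrank (ZMod p) F := by
      rw [Module.natCard_eq_pow_finrank (K := ZMod p), Nat.card_zmod]
    let f : A →* F :=
      { toFun := fun a => ψ a
        map_one' := hφi ((hψ 1 A.one_mem).trans (by simp))
        map_mul' := fun a b => hφi (by
          rw [map_mul, hψ _ a.2, hψ _ b.2, hψ _ (a * b).2]; simp) }
    have hf : Function.Injective f := fun a b hab => Subtype.ext (hρ (by
      rw [← hψ _ a.2, ← hψ _ b.2]; exact congrArg φ hab))
    rw [← hc, ← Nat.card_units]
    refine Subgroup.card_dvd_of_injective f.toHomUnits fun a b hab => hf ?_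
    simpa using congrArg Units.val hab
  · intro h
    have hk : ∀ x, ∃ y, φ y = ρ h * φ x * ρ h⁻¹ := fun x => by
      have : φ x ∈ Algebra.adjoin (ZMod p) (ρ '' (A : Set H)) := hφ ▸ ⟨x, rfl⟩
      have := conj_mem_adjoin h this
      rw [← hφ] at this
      exact this
    choose σ hσ using hk
    have h1 : ρ h⁻¹ * ρ h = 1 := by rw [← map_mul]; simp
    have h2 : ρ h * ρ h⁻¹ = 1 := by rw [← map_mul]; simp
    let s : F →ₐ[ZMod p] F :=
      { toFun := σ
        map_one' := hφi (by rw [hσ]; simp [h2])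
        map_mul' := fun a b => hφi (by
          rw [map_mul, hσ, hσ, hσ, map_mul]
          simp only [mul_assoc]
          rw [← mul_assoc (ρ h⁻¹) (ρ h), h1, one_mul])
        map_zero' := hφi (by rw [hσ]; simp)
        map_add' := fun a b => hφi (by
          rw [map_add, hσ, hσ, hσ, map_add, mul_add, add_mul])
        commutes' := fun c => hφi (by
          rw [hσ, AlgHom.commutes, ← Algebra.commutes, mul_assoc, h2, mul_one]) }
    have hs : Function.Bijective s := Finite.injective_iff_bijective.1 s.toRingHom.injective
    obtain ⟨i, hi, hpow⟩ := exists_eq_pow_of_algEquiv (AlgEquiv.ofBijective s hs)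
    refine ⟨i, hi, fun a ha => hρ ?_⟩
    have h3 : σ (ψ a) = ψ a ^ p ^ i := hpow (ψ a)
    have h4 := congrArg φ h3
    rw [hσ, map_pow, hψ a ha] at h4
    rw [map_mul, map_mul, h4, map_pow]
  · intro hd x y hx hy
    have h1 : Module.finrank F V = 1 := by
      have : 0 < Module.finrank (ZMod p) F := Module.finrank_pos
      rw [← hd] at hmul
      exact Nat.eq_of_mul_eq_mul_left this (by rw [hmul, mul_one])
    obtain ⟨v, hv0, hv⟩ := finrank_eq_one_iff'.1 h1
    obtain ⟨c, hc⟩ := hv (ρ x v)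
    have hxc : ρ x = φ c := by
      ext u
      obtain ⟨b, rfl⟩ := hv u
      rw [hsmul, ← Module.End.mul_apply, (hcomφ x hx b).eq, Module.End.mul_apply, ← hc, hsmul,
        ← Module.End.mul_apply, ← Module.End.mul_apply, ← map_mul, ← map_mul, mul_comm]
    apply hρ
    rw [map_mul, map_mul, hxc, (hcomφ y hy c).eq]
  · intro hd a ha
    obtain ⟨c, hc⟩ := (finrank_eq_one_iff_of_nonzero' (1 : F) one_ne_zero).1 hd (ψ a)
    exact ⟨c, by rw [← hψ a ha, ← hc, map_smul, map_one, Algebra.algebraMap_eq_smul_one]⟩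

end FreeLinearAction

/-- If every element acts on `A` by one of `d` power maps, the centralizer of `A` has index at most
`d`, and in the extreme case all power maps occur. -/
theorem centralizer_index_le_of_conj_eq_pow {H : Type*} [Group H] {A : Subgroup H} {d p : ℕ}
    (h : ∀ h, ∃ i < d, ∀ a ∈ A, h * a * h⁻¹ = a ^ p ^ i) :
    (Subgroup.centralizer (A : Set H)).index ≤ d ∧
      ((Subgroup.centralizer (A : Set H)).index = d →
        ∀ i < d, ∃ h, ∀ a ∈ A, h * a * h⁻¹ = a ^ p ^ i) := by
  choose i hi hpow using h
  let f : H ⧸ Subgroup.centralizer (A : Set H) → Fin d := fun q => ⟨i q.out, hi _⟩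
  have hf : Function.Injective f := by
    intro q r hqr
    have hqr : i q.out = i r.out := congrArg Fin.val hqr
    rw [← q.out_eq', ← r.out_eq', QuotientGroup.eq]
    rw [Subgroup.mem_centralizer_iff]
    intro a ha
    have h1 := (hpow q.out a ha).trans ((hqr ▸ hpow r.out a ha).symm)
    calc a * (q.out⁻¹ * r.out) = q.out⁻¹ * (q.out * a * q.out⁻¹) * r.out := by group
      _ = q.out⁻¹ * (r.out * a * r.out⁻¹) * r.out := by rw [h1]
      _ = q.out⁻¹ * r.out * a := by group
  refine ⟨by simpa [Subgroup.index] using Nat.card_le_card_of_injective f hf, fun hd j hj => ?_⟩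
  have hbij : Function.Bijective f := hf.bijective_of_nat_card_le (by
    rw [Nat.card_eq_fintype_card, Fintype.card_fin]; exact hd.ge)
  obtain ⟨q, hq⟩ := hbij.2 ⟨j, hj⟩
  refine ⟨q.out, fun a ha => ?_⟩
  rw [hpow _ a ha, show i q.out = j from congrArg Fin.val hq]

theorem minimalPeriod_le_ncard {α : Type*} {f : α → α} {S : Set α} (hS : S.Finite)
    (hf : ∀ s ∈ S, f s ∈ S) {s : α} (hs : s ∈ S) : Function.minimalPeriod f s ≤ S.ncard := by
  have hmem : ∀ n, f^[n] s ∈ S := by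
    intro n
    induction n with
    | zero => exact hs
    | succ n ih => rw [Function.iterate_succ_apply']; exact hf _ ih
  have := Set.ncard_le_ncard_of_injOn (f^[·] s) (fun n _ => hmem n)
    (Function.iterate_injOn_Iio_minimalPeriod (f := f) (x := s)) hS
  simpa [Set.ncard_eq_toFinset_card'] using this

theorem conj_iterate {Q : Type*} [Group Q] (x b : Q) (n : ℕ) :
    (fun q => x * q * x⁻¹)^[n] b = x ^ n * b * (x ^ n)⁻¹ := by
  induction n with
  | zero => simp
  | succ n ih => rw [Function.iterate_succ_apply', ih, pow_succ']; group

/-- If the finite set `S` is stable under conjugation by `x`, then the length of the orbit of any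
of its elements is at most the size of `S`. -/
theorem exists_dvd_le_commute_pow {Q : Type*} [Group Q] {S : Set Q} (hS : S.Finite) {x b : Q}
    (hx : ∀ s ∈ S, x * s * x⁻¹ ∈ S) (hb : b ∈ S) {m : ℕ} (hm : Commute (x ^ m) b) :
    ∃ j, j ∣ m ∧ j ≤ S.ncard ∧ Commute (x ^ j) b := by
  refine ⟨Function.minimalPeriod (fun q => x * q * x⁻¹) b, ?_, minimalPeriod_le_ncard hS hx hb, ?_⟩
  · refine Function.IsPeriodicPt.minimalPeriod_dvd ?_
    rw [Function.IsPeriodicPt, Function.IsFixedPt, conj_iterate, hm.eq, mul_inv_cancel_right]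
  · have := Function.iterate_minimalPeriod (f := fun q => x * q * x⁻¹) (x := b)
    rw [conj_iterate, mul_inv_eq_iff_eq_mul] at this
    exact this

/-- A group is small if two of its elements have few conjugates and few common centralizing
elements. -/
theorem card_le_of_conj_mem {Q : Type*} [Group Q] [Finite Q] [DecidableEq Q] {T : Finset Q}
    {b c : Q} (hbc : b ≠ c) (hT : ∀ q, Commute q b → Commute q c → q ∈ T) (hcard : T.card ≤ 4)
    (hb : ∀ q, q * b * q⁻¹ ∈ T.erase 1) (hc : ∀ q, q * c * q⁻¹ ∈ T.erase 1) :
    Nat.card Q ≤ 24 := by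
  have := Fintype.ofFinite Q
  have h1 : (1 : Q) ∈ T := hT 1 (Commute.one_left _) (Commute.one_left _)
  have hT3 : (T.erase 1).card ≤ 3 := by rw [Finset.card_erase_of_mem h1]; lia
  have hoff : (T.erase 1).offDiag.card ≤ 6 := by
    rw [Finset.offDiag_card]
    interval_cases (T.erase 1).card <;> simp
  have key : (Finset.univ : Finset Q).card ≤ 4 * (T.erase 1).offDiag.card := by
    refine Finset.card_le_mul_card_image_of_maps_to
      (f := fun q => (q * b * q⁻¹, q * c * q⁻¹)) (fun q _ => ?_) 4 ?_
    · rw [Finset.mem_offDiag]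
      exact ⟨hb q, hc q, fun h => hbc (by simpa using h)⟩
    · intro s _
      by_cases he : ∃ r : Q, (r * b * r⁻¹, r * c * r⁻¹) = s
      · obtain ⟨r, rfl⟩ := he
        refine (Finset.card_le_card (t := T.image (r * ·)) fun q hq => ?_).trans
          (Finset.card_image_le.trans hcard)
        rw [Finset.mem_filter, Prod.mk.injEq] at hq
        refine Finset.mem_image.2 ⟨r⁻¹ * q, hT _ ?_ ?_, by simp⟩
        · calc r⁻¹ * q * b = r⁻¹ * (q * b * q⁻¹) * q := by group
            _ = r⁻¹ * (r * b * r⁻¹) * q := by rw [hq.2.1]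
            _ = b * (r⁻¹ * q) := by group
        · calc r⁻¹ * q * c = r⁻¹ * (q * c * q⁻¹) * q := by group
            _ = r⁻¹ * (r * c * r⁻¹) * q := by rw [hq.2.2]
            _ = c * (r⁻¹ * q) := by group
      · rw [Finset.filter_eq_empty_iff.2 fun q _ hq => he ⟨q, hq⟩]
        simp
  rw [Nat.card_eq_fintype_card, ← Finset.card_univ]
  lia

/-- Conjugation by an element that multiplies `b` and `c` by powers of their central commutator `z`
agrees on `b` and `c` with conjugation by one of `1`, `b`, `c`, `b * c`. -/
theorem exists_conj_eq_of_commutator {H : Type*} [Group H] {b c z y z₁ z₂ : H}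
    (hz : z ∈ Subgroup.center H) (hz2 : z ^ 2 = 1) (hbc : b * c * b⁻¹ = z * c)
    (hb : y * b * y⁻¹ = z₁ * b) (hc : y * c * y⁻¹ = z₂ * c)
    (h₁ : z₁ = 1 ∨ z₁ = z) (h₂ : z₂ = 1 ∨ z₂ = z) :
    ∃ w, (w = 1 ∨ w = b ∨ w = c ∨ w = b * c) ∧ y * b * y⁻¹ = w * b * w⁻¹ ∧
      y * c * y⁻¹ = w * c * w⁻¹ := by
  have hzz : z * z = 1 := by rw [← sq, hz2]
  have hcom : ∀ g, g * z = z * g := Subgroup.mem_center_iff.1 hz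
  have hcb : c * b * c⁻¹ = z * b := by
    have h1 : b * c = z * c * b := by rw [← hbc]; group
    have h2 : c * b = z * (b * c) := by rw [h1, ← mul_assoc, ← mul_assoc, hzz, one_mul]
    rw [h2]; group
  have hbcb : b * c * b * (b * c)⁻¹ = z * b := by
    calc b * c * b * (b * c)⁻¹ = b * (c * b * c⁻¹) * b⁻¹ := by group
      _ = b * z := by rw [hcb]; group
      _ = z * b := hcom b
  have hbcc : b * c * c * (b * c)⁻¹ = z * c := by
    rw [← hbc]; group
  rw [hb, hc]
  rcases h₁ with rfl | rfl <;> rcases h₂ with rfl | rfl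
  · exact ⟨1, Or.inl rfl, by simp, by simp⟩
  · exact ⟨b, Or.inr (Or.inl rfl), by simp, hbc.symm⟩
  · exact ⟨c, Or.inr (Or.inr (Or.inl rfl)), hcb.symm, by simp⟩
  · exact ⟨b * c, Or.inr (Or.inr (Or.inr rfl)), hbcb.symm, hbcc.symm⟩

section FreeLinearAction

variable {p : ℕ} [Fact p.Prime] {V : Type*} [AddCommGroup V] [Module (ZMod p) V]
  {H : Type*} [Group H] {ρ : H →* Module.End (ZMod p) V}

/-- In dimension two the centralizer of a nonscalar element is commutative. -/
theorem commute_of_not_scalar [Finite V] [Nontrivial V]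
    (hfree : ∀ h v, v ≠ 0 → ρ h v = v → h = 1) (hV : Module.finrank (ZMod p) V = 2) {x : H}
    (hx : ¬ ∃ c : ZMod p, ρ x = algebraMap _ _ c) {y z : H} (hy : Commute x y)
    (hz : Commute x z) : Commute y z := by
  by_cases h : ∀ v, ¬ LinearIndependent (ZMod p) ![v, ρ x v]
  · obtain ⟨c, hc⟩ := LinearMap.exists_eq_smul_id_of_forall_notLinearIndependent h
    exact absurd ⟨c, by rw [hc, Algebra.algebraMap_eq_smul_one]⟩ hx
  · push Not at h
    obtain ⟨v, hv⟩ := h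
    have htop := hv.span_eq_top_of_card_eq_finrank' (by simp [hV])
    refine commute_of_span_pow_eq_top hfree (v := v) (top_le_iff.1 ?_) hy hz
    rw [← htop]
    refine Submodule.span_mono ?_
    rintro _ ⟨i, rfl⟩
    fin_cases i
    · exact ⟨0, by simp⟩
    · exact ⟨1, by simp⟩

/-- A scalar commutator in dimension two squares to one. -/
theorem sq_eq_one_of_commutator_scalar [Finite V] [Nontrivial V]
    (hfree : ∀ h v, v ≠ 0 → ρ h v = v → h = 1) (hV : Module.finrank (ZMod p) V = 2)
    {x y z : H} (hz : ∃ c : ZMod p, ρ z = algebraMap _ _ c) (h : x * y * x⁻¹ = z * y) :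
    z ^ 2 = 1 := by
  obtain ⟨c, hc⟩ := hz
  have hdet : LinearMap.det (ρ y) ≠ 0 := by
    have h1 : LinearMap.det (ρ y) * LinearMap.det (ρ y⁻¹) = 1 := by
      rw [← map_mul, ← map_mul, mul_inv_cancel, map_one, map_one]
    exact left_ne_zero_of_mul_eq_one h1
  have hx : LinearMap.det (ρ x) * LinearMap.det (ρ x⁻¹) = 1 := by
    rw [← map_mul, ← map_mul, mul_inv_cancel, map_one, map_one]
  have h1 := congrArg (fun g => LinearMap.det (ρ g)) h
  simp only [map_mul, hc, Algebra.algebraMap_eq_smul_one, LinearMap.det_smul, hV] at h1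
  rw [map_one, mul_one, mul_right_comm, hx, one_mul] at h1
  have hc2 : c ^ 2 = 1 := (mul_eq_right₀ hdet).1 h1.symm
  apply injective_of_free hfree
  rw [map_pow, hc, ← map_pow, hc2, map_one, map_one]

/-- Commuting elements of order three generate the same subgroup. -/
theorem eq_or_eq_sq_of_commute_of_orderOf_eq_three
    (hfree : ∀ h v, v ≠ 0 → ρ h v = v → h = 1) [Nontrivial V] {x y : H} (hx : orderOf x = 3)
    (hy : orderOf y = 3) (hxy : Commute x y) : x = y ∨ x = y ^ 2 := by
  have hcyc : ∀ g : H, orderOf g = 3 → ∀ v, ρ (g ^ 2) v + ρ g v + v = 0 := by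
    intro g hg v
    by_contra hne
    have h3 : g * g ^ 2 = 1 := (pow_succ' g 2).symm.trans (orderOf_dvd_iff_pow_eq_one.1 hg.dvd)
    have : g = 1 := by
      refine hfree g _ hne ?_
      rw [map_add, map_add, ← Module.End.mul_apply, ← Module.End.mul_apply, ← map_mul, ← map_mul,
        h3, map_one, Module.End.one_apply, ← sq]
      abel
    rw [this, orderOf_one] at hg
    lia
  by_contra! hcon
  obtain ⟨hxy1, hxy2⟩ := hcon
  obtain ⟨v, hv⟩ := exists_ne (0 : V)
  have hu : ρ x v - ρ (y ^ 2) v ≠ 0 := fun h =>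
    hxy2 (eq_of_apply_eq_of_free hfree hv (sub_eq_zero.1 h))
  refine hxy1 (eq_of_apply_eq_of_free hfree hu ?_)
  have e1 := hcyc x hx v
  have e2 := hcyc y hy (ρ x v)
  have h3 : y * y ^ 2 = 1 := (pow_succ' y 2).symm.trans (orderOf_dvd_iff_pow_eq_one.1 hy.dvd)
  have hc2 : x * y ^ 2 = y ^ 2 * x := (hxy.pow_right 2).eq
  simp only [map_sub, ← Module.End.mul_apply, ← map_mul, ← sq, h3, hc2] at e2 ⊢
  rw [map_one, Module.End.one_apply, sub_eq_sub_iff_add_eq_add]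
  have e3 : ρ (x ^ 2) v + v = - ρ x v := by
    rw [eq_neg_iff_add_eq_zero, ← e1]; abel
  have e4 : ρ (y * x) v + ρ (y ^ 2 * x) v = - ρ x v := by
    rw [eq_neg_iff_add_eq_zero, ← e2]; abel
  rw [← map_pow, e3, e4]

end FreeLinearAction

section FreeLinearAction

variable {p : ℕ} [Fact p.Prime] {V : Type*} [AddCommGroup V] [Module (ZMod p) V]
  {H : Type*} [Group H] {ρ : H →* Module.End (ZMod p) V}

theorem isCyclic_of_normal_commutative [Finite V] [Nontrivial V] [Finite H]
    (hfree : ∀ h v, v ≠ 0 → ρ h v = v → h = 1)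
    (htrans : ∀ u v : V, u ≠ 0 → v ≠ 0 → ∃ h, ρ h u = v) {A : Subgroup H} [A.Normal]
    (hA : ∀ a ∈ A, ∀ b ∈ A, a * b = b * a) : IsCyclic A :=
  isCyclic_of_injective_adjoin hfree hA (injective_adjoin_of_transitive htrans hA)

theorem scalar_of_normal_commutative [Finite V] [Nontrivial V] [Finite H]
    (hfree : ∀ h v, v ≠ 0 → ρ h v = v → h = 1)
    (htrans : ∀ u v : V, u ≠ 0 → v ≠ 0 → ∃ h, ρ h u = v)
    (hV : Module.finrank (ZMod p) V = 2) (hcard : Nat.card H = p ^ 2 - 1)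
    (hsm : ∀ r : ℕ, r.Prime → r ∣ Nat.card H → r = 2 ∨ r = 3 ∨ r = 5)
    (h2 : 2 ∣ Nat.card H) (h3 : 3 ∣ Nat.card H) (h5 : 5 ∣ Nat.card H)
    (hpoc : PerfectOrderClasses H) {A : Subgroup H} [A.Normal]
    (hA : ∀ a ∈ A, ∀ b ∈ A, a * b = b * a) :
    Nat.card A ∣ p - 1 ∧ ∀ a ∈ A, ∃ c : ZMod p, ρ a = algebraMap _ _ c := by
  obtain ⟨d, hd0, hd, hAd, hconj, hcent, hscal⟩ := normal_commutative_structure hfree htrans hA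
  rw [hV] at hd
  rcases (Nat.dvd_prime Nat.prime_two).1 hd with rfl | rfl
  · exact ⟨by simpa using hAd, hscal rfl⟩
  exfalso
  set C := Subgroup.centralizer (A : Set H) with hC
  have hCcomm : ∀ a ∈ C, ∀ b ∈ C, a * b = b * a := fun a ha b hb =>
    hcent hV.symm a b (Subgroup.mem_centralizer_iff.1 ha) (Subgroup.mem_centralizer_iff.1 hb)
  have hcyc : IsCyclic C := isCyclic_of_normal_commutative hfree htrans hCcomm
  have hidx : C.index ≤ 2 := (centralizer_index_le_of_conj_eq_pow hconj).1
  have hidx0 : C.index ≠ 0 := Subgroup.index_ne_zero_of_finite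
  have hmul : Nat.card C * C.index = Nat.card H := Subgroup.card_mul_index C
  have htot : (Nat.card C).totient ∣ Nat.card H := hpoc.totient_card_dvd C
  have hpos : 0 < Nat.card C := Nat.card_pos
  have hodd : p % 2 = 1 := by
    have hp := (Fact.out : p.Prime)
    rcases hp.eq_two_or_odd with rfl | h
    · rw [hcard] at h2; lia
    · exact h
  have h4 : 4 ∣ Nat.card H := by
    obtain ⟨k, hk⟩ : ∃ k, p = 2 * k + 1 := ⟨p / 2, by lia⟩
    rw [hcard, hk]
    exact ⟨k * k + k, by
      rw [show (2 * k + 1) ^ 2 = 4 * (k * k + k) + 1 by ring, Nat.add_sub_cancel]⟩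
  have hC30 : 2 ∣ Nat.card C ∧ 3 ∣ Nat.card C ∧ 5 ∣ Nat.card C := by
    interval_cases C.index <;> lia
  have hφ := totient_of_smooth hpos hC30.1 hC30.2.1 hC30.2.2 fun r hr hrC =>
    hsm r hr (hrC.trans ⟨_, hmul.symm⟩)
  obtain ⟨q, hq⟩ := htot
  have hφ0 : 0 < (Nat.card C).totient := Nat.totient_pos.2 hpos
  have : C.index * 30 = 8 * q := by
    apply Nat.eq_of_mul_eq_mul_left hφ0
    calc (Nat.card C).totient * (C.index * 30) = (Nat.card C).totient * 30 * C.index := by ring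
      _ = Nat.card C * C.index * 8 := by rw [hφ]; ring
      _ = _ := by rw [hmul, hq]; ring
  lia

theorem commutator_pow {H : Type*} [Group H] {b c z : H} (hz : Commute b z)
    (h : b * c * b⁻¹ = z * c) (n : ℕ) : b ^ n * c * (b ^ n)⁻¹ = z ^ n * c := by
  induction n with
  | zero => simp
  | succ n ih =>
    have hzn : b * z ^ n = z ^ n * b := (hz.pow_right n).eq
    calc b ^ (n + 1) * c * (b ^ (n + 1))⁻¹ = b * (b ^ n * c * (b ^ n)⁻¹) * b⁻¹ := by
          rw [pow_succ']; group
      _ = z ^ n * (b * c * b⁻¹) := by rw [ih, ← mul_assoc, hzn]; group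
      _ = z ^ (n + 1) * c := by rw [h, pow_succ, mul_assoc]

/-- If all elements of order five are central, the number of elements of order three is limited. -/
theorem PerfectOrderClasses.four_mul_orderCount_three_dvd [Finite H] (hpoc : PerfectOrderClasses H)
    (h3 : 3 ∣ Nat.card H) (h5 : 5 ∣ Nat.card H)
    (hcent : ∀ x : H, orderOf x = 5 → x ∈ Subgroup.center H) :
    4 * orderCount H 3 ∣ Nat.card H := by
  have : Fact (Nat.Prime 3) := ⟨Nat.prime_three⟩
  have : Fact (Nat.Prime 5) := ⟨Nat.prime_five⟩
  obtain ⟨x, hx⟩ := exists_prime_orderOf_dvd_card' 5 h5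
  obtain ⟨y, hy⟩ := exists_prime_orderOf_dvd_card' 3 h3
  have hcomm : ∀ a b : H, orderOf b = 5 → Commute a b := fun a b hb =>
    Subgroup.mem_center_iff.1 (hcent b hb) a
  have h15 : orderCount H (3 * 5) = orderCount H 3 * orderCount H 5 := by
    rw [orderCount_mul_of_coprime H (by lia) (by lia) (by norm_num), orderCount, orderCount,
      ← Nat.card_prod]
    exact Nat.card_congr
      { toFun := fun s => (⟨s.1.1, s.2.1⟩, ⟨s.1.2, s.2.2.1⟩)
        invFun := fun s => ⟨(s.1.1, s.2.1), s.1.2, s.2.2, hcomm _ _ s.2.2⟩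
        left_inv := fun _ => rfl
        right_inv := fun _ => rfl }
  have hord : orderOf (y * x) = 15 := by
    rw [(hcomm y x hx).orderOf_mul_eq_mul_orderOf_of_coprime (by rw [hx, hy]; norm_num), hx, hy]
  have hdvd := hpoc.orderCount_dvd (y * x)
  rw [hord, show 15 = 3 * 5 from rfl, h15] at hdvd
  have h4 : 4 ∣ orderCount H 5 := totient_dvd_orderCount H (n := 5) (by lia)
  rw [mul_comm]
  exact (mul_dvd_mul_left _ h4).trans hdvd

theorem orderCount_three_mod_three [Finite H] [Nontrivial V]
    (hfree : ∀ h v, v ≠ 0 → ρ h v = v → h = 1) {y : H} (hy : orderOf y = 3) :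
    orderCount H 3 % 3 = 2 := by
  have : Fact (Nat.Prime 3) := ⟨Nat.prime_three⟩
  let _ : MulAction (Subgroup.zpowers y) {x : H // orderOf x = 3} :=
    { smul := fun g x => ⟨g * x.1 * (g : H)⁻¹, by
        have := (MulAut.conj (g : H)).orderOf_eq x.1
        rw [MulAut.conj_apply] at this
        rw [this, x.2]⟩
      one_smul := fun x => Subtype.ext (by change (1 : H) * x.1 * (1 : H)⁻¹ = x.1; simp)
      mul_smul := fun g k x => Subtype.ext (by
        change (g * k : H) * x.1 * (g * k : H)⁻¹ = g * (k * x.1 * (k : H)⁻¹) * (g : H)⁻¹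
        group) }
  have hsmul : ∀ (g : Subgroup.zpowers y) (x : {x : H // orderOf x = 3}),
      (g • x).1 = g * x.1 * (g : H)⁻¹ := fun _ _ => rfl
  have hP : IsPGroup 3 (Subgroup.zpowers y) :=
    IsPGroup.of_card (n := 1) (by rw [Nat.card_zpowers, hy, pow_one])
  have hy2 : orderOf (y ^ 2) = 3 := by
    rw [orderOf_pow, hy]; norm_num
  have hne : y ≠ y ^ 2 := by
    intro h
    have h1 : y = 1 := by simpa [sq] using h
    rw [h1, orderOf_one] at hy
    lia
  have hfix : MulAction.fixedPoints (Subgroup.zpowers y) {x : H // orderOf x = 3} =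
      {⟨y, hy⟩, ⟨y ^ 2, hy2⟩} := by
    ext x
    rw [MulAction.mem_fixedPoints]
    constructor
    · intro h
      have h1 := congrArg Subtype.val (h ⟨y, Subgroup.mem_zpowers y⟩)
      rw [hsmul, mul_inv_eq_iff_eq_mul] at h1
      rcases eq_or_eq_sq_of_commute_of_orderOf_eq_three hfree x.2 hy h1.symm with h2 | h2
      · exact Or.inl (Subtype.ext h2)
      · exact Or.inr (Subtype.ext h2)
    · rintro (rfl | rfl) ⟨g, k, rfl⟩
      · refine Subtype.ext ?_
        rw [hsmul, mul_inv_eq_iff_eq_mul]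
        exact ((Commute.refl y).zpow_left k).eq
      · refine Subtype.ext ?_
        rw [hsmul, mul_inv_eq_iff_eq_mul]
        exact (((Commute.refl y).zpow_left k).pow_right 2).eq
  have hmod := hP.card_modEq_card_fixedPoints {x : H // orderOf x = 3}
  rw [hfix, Nat.card_coe_set_eq, Set.ncard_pair (fun h => hne (congrArg Subtype.val h))] at hmod
  exact hmod

/-- If the commutative normal subgroups of a planar group are scalar, the quotient by the center is
small and contains no element of order five. -/
theorem center_of_normal_commutative_scalar [Finite V] [Nontrivial V] [Finite H]
    [Group.IsSolvable H] (hfree : ∀ h v, v ≠ 0 → ρ h v = v → h = 1)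
    (hV : Module.finrank (ZMod p) V = 2) (hnc : Subgroup.center H ≠ ⊤)
    (hscal : ∀ A : Subgroup H, A.Normal → (∀ a ∈ A, ∀ b ∈ A, a * b = b * a) →
      ∀ a ∈ A, ∃ c : ZMod p, ρ a = algebraMap _ _ c) :
    Nat.card (H ⧸ Subgroup.center H) ≤ 24 ∧
      ∀ x : H, orderOf x = 5 → x ∈ Subgroup.center H := by
  classical
  have hcen : ∀ x : H, (∃ c : ZMod p, ρ x = algebraMap _ _ c) → x ∈ Subgroup.center H := by
    rintro x ⟨c, hc⟩
    refine Subgroup.mem_center_iff.2 fun g => injective_of_free hfree ?_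
    rw [map_mul, map_mul, hc, Algebra.commutes]
  have hZs := hscal (Subgroup.center H) inferInstance
    fun a _ b hb => Subgroup.mem_center_iff.1 hb a
  obtain ⟨B, r, hBn, hZB, -, hr, hBcomm, hBr⟩ :=
    exists_normal_elementary_section (A := Subgroup.center H) (C := ⊤) (lt_top_iff_ne_top.2 hnc)
  have hBnc : ∃ b ∈ B, ∃ c ∈ B, b * c ≠ c * b := by
    by_contra! h
    exact hZB.not_ge fun b hb => hcen b (hscal B hBn h b hb)
  obtain ⟨b, hb, c, hc, hbc⟩ := hBnc
  have hcomsq : ∀ x y : H, x * y * x⁻¹ * y⁻¹ ∈ Subgroup.center H →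
      (x * y * x⁻¹ * y⁻¹) ^ 2 = 1 := fun x y h =>
    sq_eq_one_of_commutator_scalar hfree hV (hZs _ h) (x := x) (y := y) (by group)
  set z := b * c * b⁻¹ * c⁻¹ with hz
  have hzZ : z ∈ Subgroup.center H := hBcomm b hb c hc
  have hz2 : z ^ 2 = 1 := hcomsq b c hzZ
  have hz1 : z ≠ 1 := fun h => hbc (by
    rw [hz, mul_inv_eq_one, mul_inv_eq_iff_eq_mul] at h
    exact h)
  have hbcz : b * c * b⁻¹ = z * c := by rw [hz]; group
  have hr2 : r = 2 := by
    rcases hr.eq_two_or_odd' with h | ⟨k, hk⟩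
    · exact h
    · exfalso
      have h1 := commutator_pow (Subgroup.mem_center_iff.1 hzZ b) hbcz r
      have h4 := Subgroup.mem_center_iff.1 (hBr b hb) c
      rw [← h4, mul_inv_cancel_right, right_eq_mul, hk, pow_succ, pow_mul, hz2, one_pow,
        one_mul] at h1
      exact hz1 h1
  subst hr2
  have hcomz : ∀ x y : H, x * y * x⁻¹ * y⁻¹ ∈ Subgroup.center H →
      x * y * x⁻¹ * y⁻¹ = 1 ∨ x * y * x⁻¹ * y⁻¹ = z := fun x y h => by
    by_cases h1 : x * y * x⁻¹ * y⁻¹ = 1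
    · exact Or.inl h1
    · exact Or.inr (eq_of_sq_eq_one hfree (hcomsq x y h) h1 hz2 hz1)
  have hcover : ∀ y : H, y * b * y⁻¹ * b⁻¹ ∈ Subgroup.center H →
      y * c * y⁻¹ * c⁻¹ ∈ Subgroup.center H →
      ∃ w, (w = 1 ∨ w = b ∨ w = c ∨ w = b * c) ∧ w⁻¹ * y ∈ Subgroup.center H := by
    intro y h1 h4
    obtain ⟨w, hw, hwb, hwc⟩ := exists_conj_eq_of_commutator (y := y) hzZ hz2 hbcz
      (by group) (by group) (hcomz y b h1) (hcomz y c h4)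
    refine ⟨w, hw, ?_⟩
    by_contra hy
    refine hbc (commute_of_not_scalar hfree hV (fun hs => hy (hcen _ hs)) (x := w⁻¹ * y) ?_ ?_)
    · calc w⁻¹ * y * b = w⁻¹ * (y * b * y⁻¹) * y := by group
        _ = w⁻¹ * (w * b * w⁻¹) * y := by rw [hwb]
        _ = b * (w⁻¹ * y) := by group
    · calc w⁻¹ * y * c = w⁻¹ * (y * c * y⁻¹) * y := by group
        _ = w⁻¹ * (w * c * w⁻¹) * y := by rw [hwc]
        _ = c * (w⁻¹ * y) := by group
  let π : H →* H ⧸ Subgroup.center H := QuotientGroup.mk' _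
  have hπ : ∀ x y : H, Commute (π x) (π y) ↔ x * y * x⁻¹ * y⁻¹ ∈ Subgroup.center H := by
    intro x y
    rw [← QuotientGroup.eq_one_iff]
    change _ ↔ π (x * y * x⁻¹ * y⁻¹) = 1
    rw [map_mul, map_mul, map_mul, map_inv, map_inv, mul_inv_eq_one, mul_inv_eq_iff_eq_mul]
    rfl
  have hπ1 : ∀ x : H, π x = 1 ↔ x ∈ Subgroup.center H := fun x => QuotientGroup.eq_one_iff x
  let T : Finset (H ⧸ Subgroup.center H) := {1, π b, π c, π b * π c}
  have hT : ∀ q, Commute q (π b) → Commute q (π c) → q ∈ T := by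
    intro q h1 h4
    obtain ⟨y, rfl⟩ := QuotientGroup.mk'_surjective _ q
    obtain ⟨w, hw, hwy⟩ := hcover y ((hπ y b).1 h1) ((hπ y c).1 h4)
    have hyw : π y = π w := by
      rw [← hπ1, map_mul, map_inv, inv_mul_eq_one] at hwy
      exact hwy.symm
    change π y ∈ T
    rw [hyw]
    rcases hw with rfl | rfl | rfl | rfl <;> simp [T]
  have hT4 : T.card ≤ 4 := Finset.card_le_four
  have hBT : ∀ x ∈ B, π x ∈ T := fun x hx =>
    hT _ ((hπ x b).2 (hBcomm x hx b hb)) ((hπ x c).2 (hBcomm x hx c hc))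
  have hbcen : b ∉ Subgroup.center H := fun h => hbc (Subgroup.mem_center_iff.1 h c).symm
  have hccen : c ∉ Subgroup.center H := fun h => hbc (Subgroup.mem_center_iff.1 h b)
  have hBTc : ∀ x ∈ B, x ∉ Subgroup.center H → ∀ q, q * π x * q⁻¹ ∈ T.erase 1 := by
    intro x hx hxc q
    obtain ⟨y, rfl⟩ := QuotientGroup.mk'_surjective _ q
    refine Finset.mem_erase.2 ⟨fun h => hxc ?_, ?_⟩
    · rw [mul_inv_eq_one, mul_eq_left] at h
      exact (hπ1 x).1 h
    · have := hBT _ (hBn.conj_mem x hx y)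
      rwa [map_mul, map_mul, map_inv] at this
  have hπbc : π b ≠ π c := by
    intro h
    rw [← inv_mul_eq_one, ← map_inv, ← map_mul, hπ1] at h
    refine hbc ?_
    have h1 := Subgroup.mem_center_iff.1 h b
    rw [mul_inv_cancel_left] at h1
    calc b * c = b * (b⁻¹ * c * b) := congrArg (b * ·) h1
      _ = c * b := by group
  have hQ : Nat.card (H ⧸ Subgroup.center H) ≤ 24 :=
    card_le_of_conj_mem hπbc hT hT4 (hBTc b hb hbcen) (hBTc c hc hccen)
  have hT3 : ((T.erase 1 : Finset _) : Set (H ⧸ Subgroup.center H)).ncard ≤ 3 := by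
    rw [Set.ncard_coe_finset, Finset.card_erase_of_mem (by simp [T])]
    lia
  refine ⟨hQ, fun x hx => ?_⟩
  have hx5 : x ^ 5 = 1 := orderOf_dvd_iff_pow_eq_one.1 hx.dvd
  have hst : ∀ s ∈ ((T.erase 1 : Finset _) : Set (H ⧸ Subgroup.center H)),
      π x * s * (π x)⁻¹ ∈ ((T.erase 1 : Finset _) : Set (H ⧸ Subgroup.center H)) := by
    intro s hs
    obtain ⟨hs1, hsT⟩ := Finset.mem_erase.1 hs
    obtain ⟨u, huB, rfl⟩ : ∃ u ∈ B, π u = s := by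
      simp only [T, Finset.mem_insert, Finset.mem_singleton] at hsT
      rcases hsT with rfl | rfl | rfl | rfl
      · exact ⟨1, B.one_mem, map_one π⟩
      · exact ⟨b, hb, rfl⟩
      · exact ⟨c, hc, rfl⟩
      · exact ⟨b * c, B.mul_mem hb hc, map_mul π b c⟩
    exact hBTc u huB (fun h => hs1 ((hπ1 u).2 h)) (π x)
  have hfix : ∀ u ∈ B, u ∉ Subgroup.center H → Commute (π x) (π u) := by
    intro u hu huc
    have huT : π u ∈ ((T.erase 1 : Finset _) : Set (H ⧸ Subgroup.center H)) := by
      have := hBTc u hu huc 1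
      rwa [one_mul, inv_one, mul_one] at this
    obtain ⟨j, hj5, hj, hcom⟩ := exists_dvd_le_commute_pow (Finset.finite_toSet _) hst huT
      (m := 5) (by rw [← map_pow, hx5, map_one]; exact Commute.one_left _)
    rcases (Nat.dvd_prime Nat.prime_five).1 hj5 with rfl | rfl
    · rwa [pow_one] at hcom
    · lia
  obtain ⟨w, hw, hwx⟩ := hcover x ((hπ x b).1 (hfix b hb hbcen)) ((hπ x c).1 (hfix c hc hccen))
  have hwB : w ∈ B := by
    rcases hw with rfl | rfl | rfl | rfl
    exacts [B.one_mem, hb, hc, B.mul_mem hb hc]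
  have hxB : x ∈ B := by simpa using B.mul_mem hwB (hZB.le hwx)
  have h6 : x = (x ^ 2) ^ 3 := by
    rw [← pow_mul, show 2 * 3 = 5 + 1 from rfl, pow_succ, hx5, one_mul]
  rw [h6]
  exact Subgroup.pow_mem _ (hBr x hxB) 3

theorem false_of_finrank_eq_two [Finite V] [Nontrivial V] [Finite H] [Group.IsSolvable H]
    (hfree : ∀ h v, v ≠ 0 → ρ h v = v → h = 1)
    (htrans : ∀ u v : V, u ≠ 0 → v ≠ 0 → ∃ h, ρ h u = v)
    (hV : Module.finrank (ZMod p) V = 2) (hcard : Nat.card H = p ^ 2 - 1)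
    (hsm : ∀ r : ℕ, r.Prime → r ∣ Nat.card H → r = 2 ∨ r = 3 ∨ r = 5)
    (h2 : 2 ∣ Nat.card H) (h3 : 3 ∣ Nat.card H) (h5 : 5 ∣ Nat.card H)
    (hnc : Subgroup.center H ≠ ⊤) (hpoc : PerfectOrderClasses H) : False := by
  have hscal : ∀ A : Subgroup H, A.Normal → (∀ a ∈ A, ∀ b ∈ A, a * b = b * a) →
      Nat.card A ∣ p - 1 ∧ ∀ a ∈ A, ∃ c : ZMod p, ρ a = algebraMap _ _ c := fun A _ hA =>
    scalar_of_normal_commutative hfree htrans hV hcard hsm h2 h3 h5 hpoc hA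
  obtain ⟨hQ, h5cen⟩ := center_of_normal_commutative_scalar hfree hV hnc
    fun A hA hAc => (hscal A hA hAc).2
  obtain ⟨hZp, -⟩ := hscal (Subgroup.center H) inferInstance
    fun a _ b hb => Subgroup.mem_center_iff.1 hb a
  have hp1 : 1 < p := (Fact.out : p.Prime).one_lt
  have : Fact (Nat.Prime 5) := ⟨Nat.prime_five⟩
  have : Fact (Nat.Prime 3) := ⟨Nat.prime_three⟩
  obtain ⟨x, hx⟩ := exists_prime_orderOf_dvd_card' 5 h5
  have h5p : 5 ∣ p - 1 := by
    rw [← hx]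
    exact (Subgroup.orderOf_dvd_natCard _ (h5cen x hx)).trans hZp
  have hp23 : p ≤ 23 := by
    have h1 : Nat.card H = Nat.card (H ⧸ Subgroup.center H) * Nat.card (Subgroup.center H) :=
      Subgroup.card_eq_card_quotient_mul_card_subgroup _
    have h4 : Nat.card (Subgroup.center H) ≤ p - 1 := Nat.le_of_dvd (by lia) hZp
    have h6 : p ^ 2 - 1 ≤ 24 * (p - 1) := by
      rw [← hcard, h1]
      exact Nat.mul_le_mul hQ h4
    obtain ⟨m, rfl⟩ : ∃ m, p = m + 1 := ⟨p - 1, by lia⟩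
    rw [show (m + 1) ^ 2 = m * (m + 2) + 1 by ring, Nat.add_sub_cancel, Nat.add_sub_cancel,
      mul_comm] at h6
    have := Nat.le_of_mul_le_mul_right h6 (by lia)
    lia
  have hp11 : p = 11 := by
    have hp := (Fact.out : p.Prime)
    interval_cases p <;> first | rfl | lia
  subst hp11
  obtain ⟨y, hy⟩ := exists_prime_orderOf_dvd_card' 3 h3
  have h43 := hpoc.four_mul_orderCount_three_dvd h3 h5 h5cen
  have hmod := orderCount_three_mod_three hfree hy
  have h23 : 2 ∣ orderCount H 3 := totient_dvd_orderCount H (n := 3) (by lia)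
  have hN : orderCount H 3 = 2 := by
    rw [hcard, show 11 ^ 2 - 1 = 4 * 30 by norm_num] at h43
    have h6 : orderCount H 3 ∣ 30 := Nat.dvd_of_mul_dvd_mul_left (by lia) h43
    have h7 := Nat.le_of_dvd (by lia) h6
    interval_cases orderCount H 3 <;> lia
  have hconj : ∀ h : H, h * y * h⁻¹ ∈ Subgroup.zpowers y := by
    intro h
    have hy2 : orderOf (y ^ 2) = 3 := by
      rw [orderOf_pow, hy]; norm_num
    have hne : y ≠ y ^ 2 := by
      intro h
      have h1 : y = 1 := by simpa [sq] using h
      rw [h1, orderOf_one] at hy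
      lia
    have hset : ({y, y ^ 2} : Set H) = {x | orderOf x = 3} := by
      refine Set.eq_of_subset_of_ncard_le ?_ ?_ (Set.toFinite _)
      · rintro _ (rfl | rfl)
        exacts [hy, hy2]
      · rw [Set.ncard_pair hne, ← Nat.card_coe_set_eq]
        exact hN.le
    have hmem : h * y * h⁻¹ ∈ ({y, y ^ 2} : Set H) := by
      rw [hset]
      exact ((MulAut.conj h).orderOf_eq y).trans hy
    rcases hmem with h1 | h1
    · rw [h1]; exact Subgroup.mem_zpowers y
    · rw [h1]; exact Subgroup.pow_mem _ (Subgroup.mem_zpowers y) 2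
  have hyn : (Subgroup.zpowers y).Normal := ⟨by
    rintro _ ⟨k, rfl⟩ h
    have := Subgroup.zpow_mem _ (hconj h) k
    rwa [conj_zpow] at this⟩
  have := (hscal (Subgroup.zpowers y) hyn (by
    rintro _ ⟨i, rfl⟩ _ ⟨j, rfl⟩
    exact ((Commute.refl y).zpow_zpow i j).eq)).1
  rw [Nat.card_zpowers, hy] at this
  lia

end FreeLinearAction

section FreeLinearAction

variable {V : Type*} [AddCommGroup V] {H : Type*} [Group H]

theorem conj_pow_of_conj_eq_pow {A : Subgroup H} {h : H} {m : ℕ}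
    (hA : ∀ a ∈ A, h * a * h⁻¹ = a ^ m) (n : ℕ) : ∀ a ∈ A, h ^ n * a * (h ^ n)⁻¹ = a ^ m ^ n := by
  induction n with
  | zero => simp
  | succ n ih =>
    intro a ha
    calc h ^ (n + 1) * a * (h ^ (n + 1))⁻¹ = h * (h ^ n * a * (h ^ n)⁻¹) * h⁻¹ := by
          rw [pow_succ']; group
      _ = (a ^ m ^ n) ^ m := by rw [ih a ha, hA _ (A.pow_mem ha _)]
      _ = a ^ m ^ (n + 1) := by rw [← pow_mul, ← pow_succ]

/-- A group with a unique involution has no self-centralizing cyclic subgroup of order `600`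
on which some element acts by seventh powers. -/
theorem false_of_conj_eq_pow_seven {A : Subgroup H} [IsCyclic A] (hcard : Nat.card A = 600)
    (hinv : ∀ s t : H, s ^ 2 = 1 → s ≠ 1 → t ^ 2 = 1 → t ≠ 1 → s = t)
    (hA : ∀ x : H, (∀ a ∈ A, Commute a x) → x ∈ A) {h : H}
    (hh : ∀ a ∈ A, h * a * h⁻¹ = a ^ 7) : False := by
  obtain ⟨⟨c, hcA⟩, hc⟩ := IsCyclic.exists_ofOrder_eq_natCard (α := A)
  rw [Subgroup.orderOf_mk, hcard] at hc
  have hc600 : c ^ 600 = 1 := hc ▸ pow_orderOf_eq_one c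
  have hexp : ∀ a ∈ A, a ^ 600 = 1 := fun a ha => by
    have := pow_card_eq_one' (x := (⟨a, ha⟩ : A))
    rw [hcard] at this
    exact congrArg Subtype.val this
  have hcomm : ∀ a ∈ A, ∀ b ∈ A, a * b = b * a := by
    let _ := IsCyclic.commGroup (α := A)
    intro a ha b hb
    exact congrArg Subtype.val (mul_comm (⟨a, ha⟩ : A) ⟨b, hb⟩)
  have hh4 : h ^ 4 ∈ A := by
    refine hA _ fun a ha => ?_
    have h1 := conj_pow_of_conj_eq_pow hh 4 a ha
    rw [show 7 ^ 4 = 600 * 4 + 1 by norm_num, pow_succ a, pow_mul a, hexp a ha, one_pow,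
      one_mul,      mul_inv_eq_iff_eq_mul] at h1
    exact h1.symm
  have hh24 : h ^ 24 = 1 := by
    have h1 := hh _ hh4
    rw [← pow_succ', pow_succ, mul_inv_cancel_right, ← pow_mul,
      show 4 * 7 = 24 + 4 by norm_num, pow_add, right_eq_mul] at h1
    exact h1
  have hh6 : ∀ a ∈ A, h ^ 6 * a * (h ^ 6)⁻¹ = a ^ 49 := fun a ha => by
    rw [conj_pow_of_conj_eq_pow hh 6 a ha, show 7 ^ 6 = 600 * 196 + 49 by norm_num, pow_add,
      pow_mul, hexp a ha, one_pow, one_mul]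
  have hnot : h ^ 6 ∉ A := by
    intro hmem
    have h1 := hh6 c hcA
    rw [hcomm _ hmem c hcA, mul_inv_cancel_right, pow_succ, right_eq_mul] at h1
    have := orderOf_dvd_of_pow_eq_one h1
    rw [hc] at this
    lia
  have hε : (c ^ 300) ^ 2 = 1 := by rw [← pow_mul]; exact hc600
  have hε1 : c ^ 300 ≠ 1 := fun h1 => by
    have := orderOf_dvd_of_pow_eq_one h1
    rw [hc] at this
    lia
  have hsq : ∀ s : H, s ^ 2 = 1 → s ∈ A := by
    intro s hs
    by_cases hs1 : s = 1
    · rw [hs1]; exact A.one_mem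
    · rw [hinv s _ hs hs1 hε hε1]; exact A.pow_mem hcA _
  by_cases h12 : h ^ 12 = 1
  · exact hnot (hsq _ (by rw [← pow_mul]; exact h12))
  · have h12' : h ^ 12 = c ^ 300 := hinv _ _ (by rw [← pow_mul]; exact hh24) h12 hε hε1
    have hj := hh6 _ (A.pow_mem hcA 150)
    rw [← pow_mul, show 150 * 49 = 600 * 12 + 150 by norm_num, pow_add c, pow_mul c, hc600,
      one_pow, one_mul, mul_inv_eq_iff_eq_mul] at hj
    have hmem : h ^ 6 * c ^ 150 ∈ A := by
      refine hsq _ ?_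
      rw [Commute.mul_pow hj, ← pow_mul, ← pow_mul, show 6 * 2 = 12 from rfl, h12', ← pow_add]
      exact hc600
    exact hnot ((A.mul_mem_cancel_right (A.pow_mem hcA 150)).1 hmem)

variable [Fact (Nat.Prime 7)] [Module (ZMod 7) V] {ρ : H →* Module.End (ZMod 7) V}

theorem eq_bot_or_top_of_invariant [Finite V] (hfree : ∀ h v, v ≠ 0 → ρ h v = v → h = 1)
    (hV : Module.finrank (ZMod 7) V = 4) {y : H} (hy : orderOf y = 5)
    (W : Submodule (ZMod 7) V) (hW : ∀ w ∈ W, ρ y w ∈ W) : W = ⊥ ∨ W = ⊤ := by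
  have hpow : ∀ g ∈ Subgroup.zpowers y, ∀ w ∈ W, ρ g w ∈ W := by
    intro g hg w hw
    have hfin : IsOfFinOrder y := by rw [← orderOf_pos_iff, hy]; lia
    rw [← hfin.mem_powers_iff_mem_zpowers] at hg
    obtain ⟨n, rfl⟩ := hg
    induction n with
    | zero => simpa using hw
    | succ n ih =>
      simp only [pow_succ', map_mul, Module.End.mul_apply] at ih ⊢
      exact hW _ ih
  let _ : MulAction (Subgroup.zpowers y) {w : W // w ≠ 0} :=
    { smul := fun g w => ⟨⟨ρ g w.1.1, hpow g g.2 _ w.1.2⟩, fun h0 => w.2 (Subtype.ext (by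
        have h1 : ρ (g : H) w.1.1 = 0 := congrArg Subtype.val h0
        have h2 : ρ (g : H)⁻¹ (ρ (g : H) w.1.1) = w.1.1 := by
          rw [← Module.End.mul_apply, ← map_mul, inv_mul_cancel, map_one, Module.End.one_apply]
        rw [← h2, h1, map_zero]
        rfl))⟩
      one_smul := fun w => Subtype.ext (Subtype.ext (by
        change ρ (1 : H) w.1.1 = w.1.1
        simp))
      mul_smul := fun g k w => Subtype.ext (Subtype.ext (by
        change ρ (g * k : H) w.1.1 = ρ (g : H) (ρ (k : H) w.1.1)
        simp)) }
  have hdvd := card_dvd_card_of_free (G := Subgroup.zpowers y) (X := {w : W // w ≠ 0})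
    fun g w hgw => Subtype.ext (hfree g w.1.1 (fun h0 => w.2 (Subtype.ext h0))
      (congrArg (fun u => u.1.1) hgw))
  have hcardW : Nat.card {w : W // w ≠ 0} = 7 ^ Module.finrank (ZMod 7) W - 1 := by
    have h1 : Nat.card W = 7 ^ Module.finrank (ZMod 7) W := by
      rw [Module.natCard_eq_pow_finrank (K := ZMod 7), Nat.card_zmod]
    have := Fintype.ofFinite W
    classical
    rw [← h1, Nat.card_eq_fintype_card, Nat.card_eq_fintype_card, Fintype.card_subtype_compl,
      Fintype.card_subtype_eq]
  rw [Nat.card_zpowers, hy, hcardW] at hdvd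
  have hle : Module.finrank (ZMod 7) W ≤ 4 := hV ▸ Submodule.finrank_le W
  have h04 : Module.finrank (ZMod 7) W = 0 ∨ Module.finrank (ZMod 7) W = 4 := by
    interval_cases Module.finrank (ZMod 7) W <;> simp_all
  rcases h04 with h | h
  · exact Or.inl (Submodule.finrank_eq_zero.1 h)
  · exact Or.inr (Submodule.eq_top_of_finrank_eq (h.trans hV.symm))

theorem commute_of_orderOf_eq_five [Finite V] [Nontrivial V]
    (hfree : ∀ h v, v ≠ 0 → ρ h v = v → h = 1)
    (hV : Module.finrank (ZMod 7) V = 4) {y : H} (hy : orderOf y = 5) {b c : H}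
    (hb : Commute y b) (hc : Commute y c) : Commute b c := by
  obtain ⟨v, hv⟩ := exists_ne (0 : V)
  refine commute_of_span_pow_eq_top hfree (v := v) ?_ hb hc
  refine (eq_bot_or_top_of_invariant hfree hV hy _ ?_).resolve_left ?_
  · intro w hw
    have : Submodule.span (ZMod 7) (Set.range fun i : ℕ => ρ (y ^ i) v) ≤
        (Submodule.span (ZMod 7) (Set.range fun i : ℕ => ρ (y ^ i) v)).comap (ρ y) := by
      rw [Submodule.span_le]
      rintro _ ⟨i, rfl⟩
      refine Submodule.subset_span ⟨i + 1, ?_⟩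
      simp only [pow_succ', map_mul, Module.End.mul_apply]
    exact this hw
  · intro h
    have : v ∈ Submodule.span (ZMod 7) (Set.range fun i : ℕ => ρ (y ^ i) v) :=
      Submodule.subset_span ⟨0, by simp⟩
    rw [h] at this
    exact hv ((Submodule.mem_bot _).1 this)

theorem exists_orderOf_eq_twentyFive [Finite V] [Nontrivial V] [Finite H]
    (hfree : ∀ h v, v ≠ 0 → ρ h v = v → h = 1)
    (hV : Module.finrank (ZMod 7) V = 4) (hcard : Nat.card H = 2400) :
    ∃ x : H, orderOf x = 25 := by
  have : Fact (Nat.Prime 5) := ⟨Nat.prime_five⟩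
  obtain ⟨P, hP⟩ := Sylow.exists_subgroup_card_pow_prime (G := H) 5 (n := 2)
    (by rw [hcard]; norm_num)
  have hPc : ∀ a ∈ P, ∀ b ∈ P, a * b = b * a := by
    intro a ha b hb
    exact congrArg Subtype.val
      ((IsPGroup.isMulCommutative_of_card_eq_prime_sq hP).is_comm.comm (⟨a, ha⟩ : P) ⟨b, hb⟩)
  obtain ⟨⟨y, hyP⟩, hy⟩ := exists_prime_orderOf_dvd_card' (G := P) 5 (by rw [hP]; norm_num)
  rw [Subgroup.orderOf_mk] at hy
  have hcyc : IsCyclic P := by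
    refine isCyclic_of_injective_adjoin hfree hPc fun e he he0 v hev => ?_
    have hcom : Commute (ρ y) e := by
      refine Algebra.commute_of_mem_adjoin_of_forall_mem_commute he ?_
      rintro _ ⟨a, ha, rfl⟩
      exact Commute.map (hPc y hyP a ha) ρ
    rcases eq_bot_or_top_of_invariant hfree hV hy (LinearMap.ker e) (fun w hw => by
      rw [LinearMap.mem_ker] at hw ⊢
      rw [← Module.End.mul_apply, ← hcom.eq, Module.End.mul_apply, hw, map_zero]) with h | h
    · have : v ∈ LinearMap.ker e := hev
      rw [h] at this
      exact (Submodule.mem_bot _).1 this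
    · exact absurd (LinearMap.ker_eq_top.1 h) he0
  obtain ⟨⟨x, hx⟩, hxo⟩ := IsCyclic.exists_ofOrder_eq_natCard (α := P)
  exact ⟨x, by rw [← Subgroup.orderOf_mk x hx, hxo, hP]; norm_num⟩

end FreeLinearAction

theorem exists_maximal_normal_commutative (H : Type*) [Group H] [Finite H] :
    ∃ A : Subgroup H, A.Normal ∧ (∀ a ∈ A, ∀ b ∈ A, a * b = b * a) ∧
      ∀ B : Subgroup H, B.Normal → (∀ a ∈ B, ∀ b ∈ B, a * b = b * a) → A ≤ B → B ≤ A := by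
  obtain ⟨A, -, hA⟩ := Finite.exists_le_maximal
    (p := fun A : Subgroup H => A.Normal ∧ ∀ a ∈ A, ∀ b ∈ A, a * b = b * a) (a := ⊥)
    ⟨inferInstance, fun a ha b hb => by
      rw [Subgroup.mem_bot.1 ha, Subgroup.mem_bot.1 hb]⟩
  exact ⟨A, hA.1.1, hA.1.2, fun B hB hBc hAB => hA.2 ⟨hB, hBc⟩ hAB⟩

/-- The image of `B` in `H ⧸ A` is small when `B` is a class-two extension with elementary
quotient inside a group of order `2400`. -/
theorem card_map_mk_le {H : Type*} [Group H] [Finite H] (hcard : Nat.card H = 2400)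
    {A B : Subgroup H} [A.Normal] {r : ℕ} (hr : r.Prime)
    (hBr : ∀ b ∈ B, b ^ r ∈ A) (hrA : r ∣ Nat.card A) (hA : Nat.card A ∣ 48) :
    Nat.card (B.map (QuotientGroup.mk' A)) ≤ 16 := by
  have : Fact r.Prime := ⟨hr⟩
  have hP : IsPGroup r (B.map (QuotientGroup.mk' A)) := by
    rintro ⟨_, b, hb, rfl⟩
    refine ⟨1, Subtype.ext ?_⟩
    rw [pow_one]
    exact (QuotientGroup.eq_one_iff _).2 (hBr b hb)
  obtain ⟨m, hm⟩ := IsPGroup.iff_card.1 hP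
  have hmul : Nat.card (B.map (QuotientGroup.mk' A)) * Nat.card A ∣ 2400 := by
    rw [← hcard, Subgroup.card_eq_card_quotient_mul_card_subgroup A]
    exact mul_dvd_mul_right (Subgroup.card_subgroup_dvd_card _) _
  have hrm : r ^ (m + 1) ∣ 2400 := by
    rw [pow_succ, ← hm]
    exact (mul_dvd_mul_left _ hrA).trans hmul
  rw [hm]
  have hr48 : r ∣ 48 := hrA.trans hA
  have hr23 : r = 2 ∨ r = 3 := by
    have h1 : r ∣ 2 ^ 4 * 3 := by norm_num; exact hr48
    rcases hr.dvd_mul.1 h1 with h | h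
    · exact Or.inl ((Nat.prime_dvd_prime_iff_eq hr Nat.prime_two).1 (hr.dvd_of_dvd_pow h))
    · exact Or.inr ((Nat.prime_dvd_prime_iff_eq hr Nat.prime_three).1 h)
  rcases hr23 with rfl | rfl
  · have h4 : m ≤ 4 := by
      by_contra! h
      have := (pow_dvd_pow 2 (show 6 ≤ m + 1 by lia)).trans hrm
      norm_num at this
    calc 2 ^ m ≤ 2 ^ 4 := Nat.pow_le_pow_right (by lia) h4
      _ = 16 := by norm_num
  · have h4 : m ≤ 0 := by
      by_contra! h
      have := (pow_dvd_pow 3 (show 2 ≤ m + 1 by lia)).trans hrm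
      norm_num at this
    calc 3 ^ m ≤ 3 ^ 0 := Nat.pow_le_pow_right (by lia) h4
      _ ≤ 16 := by norm_num

section FreeLinearAction

variable {V : Type*} [AddCommGroup V] {H : Type*} [Group H]
variable [Fact (Nat.Prime 7)] [Module (ZMod 7) V] {ρ : H →* Module.End (ZMod 7) V}

theorem false_of_small_normal_commutative [Finite V] [Nontrivial V] [Finite H]
    [Group.IsSolvable H]
    (hfree : ∀ h v, v ≠ 0 → ρ h v = v → h = 1)
    (hV : Module.finrank (ZMod 7) V = 4) (hcard : Nat.card H = 2400)
    {A : Subgroup H} [A.Normal] (hAc : ∀ a ∈ A, ∀ b ∈ A, a * b = b * a)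
    (hmax : ∀ B : Subgroup H, B.Normal → (∀ a ∈ B, ∀ b ∈ B, a * b = b * a) → A ≤ B → B ≤ A)
    (hA : Nat.card A ∣ 48) (hidx : (Subgroup.centralizer (A : Set H)).index ≤ 2) : False := by
  set C := Subgroup.centralizer (A : Set H) with hC
  have hmemC : ∀ x, x ∈ C ↔ ∀ a ∈ A, a * x = x * a := fun x => Subgroup.mem_centralizer_iff
  have hidx0 : C.index ≠ 0 := Subgroup.index_ne_zero_of_finite
  have hAC : A < C := by
    refine lt_of_le_of_ne (fun a ha => (hmemC a).2 fun b hb => hAc b hb a ha) fun h => ?_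
    have h1 := Subgroup.card_mul_index C
    have h2 := Nat.le_of_dvd (by lia) hA
    rw [hcard, ← h] at h1
    have := Nat.mul_le_mul h2 (h ▸ hidx)
    lia
  obtain ⟨B, r, hBn, hAB, hBC, hr, hBcomm, hBr⟩ := exists_normal_elementary_section hAC
  have hBnc : ∃ b ∈ B, ∃ c ∈ B, b * c ≠ c * b := by
    by_contra! h
    exact hAB.not_ge (hmax B hBn h hAB.le)
  obtain ⟨b, hb, c, hc, hbc⟩ := hBnc
  have hcom : ∀ x ∈ C, ∀ y ∈ B, x * y * x⁻¹ * y⁻¹ ∈ A → ∀ n, x ^ n * y * (x ^ n)⁻¹ =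
      (x * y * x⁻¹ * y⁻¹) ^ n * y := fun x hx y _ h n =>
    commutator_pow ((hmemC x).1 hx _ h).symm (by group) n
  have hrA : r ∣ Nat.card A := by
    have hz := hBcomm b hb c hc
    have h1 := hcom b (hBC hb) c hc hz r
    rw [(hmemC c).1 (hBC hc) _ (hBr b hb), mul_inv_cancel_right, right_eq_mul] at h1
    have : Fact r.Prime := ⟨hr⟩
    have hz1 : b * c * b⁻¹ * c⁻¹ ≠ 1 := fun h => hbc (by
      rwa [mul_inv_eq_one, mul_inv_eq_iff_eq_mul] at h)
    rw [← orderOf_eq_prime h1 hz1]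
    exact Subgroup.orderOf_dvd_natCard _ hz
  have hQ := card_map_mk_le hcard hr hBr hrA hA
  let π : H →* H ⧸ A := QuotientGroup.mk' A
  have hπ1 : ∀ x : H, π x = 1 ↔ x ∈ A := fun x => QuotientGroup.eq_one_iff x
  let S : Set (H ⧸ A) := (B.map π : Set (H ⧸ A)) \ {1}
  have hS : S.ncard ≤ 15 := by
    rw [Set.ncard_sdiff_singleton_of_mem (B.map π).one_mem]
    have : (B.map π : Set (H ⧸ A)).ncard ≤ 16 := by
      rw [← Nat.card_coe_set_eq]; exact hQ
    lia
  obtain ⟨x, hx⟩ := exists_orderOf_eq_twentyFive hfree hV hcard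
  have hst : ∀ s ∈ S, π x * s * (π x)⁻¹ ∈ S := by
    rintro _ ⟨⟨u, hu, rfl⟩, hu1⟩
    refine ⟨⟨x * u * x⁻¹, hBn.conj_mem u hu x, by simp⟩, fun h => hu1 ?_⟩
    rw [Set.mem_singleton_iff, mul_inv_eq_one, mul_eq_left] at h
    exact h
  have hx5 : orderOf (x ^ 5) = 5 := by rw [orderOf_pow, hx]; norm_num
  have hx55 : (x ^ 5) ^ 5 = 1 := orderOf_dvd_iff_pow_eq_one.1 hx5.dvd
  have hfix : ∀ u ∈ B, x ^ 5 * u * (x ^ 5)⁻¹ * u⁻¹ ∈ A := by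
    intro u hu
    have hcu : Commute (π x ^ 5) (π u) := by
      by_cases hu1 : π u = 1
      · rw [hu1]; exact Commute.one_right _
      obtain ⟨j, hj25, hj, hcomj⟩ := exists_dvd_le_commute_pow (Set.toFinite S) hst
        (b := π u) ⟨⟨u, hu, rfl⟩, hu1⟩ (m := 25) (by
          rw [← map_pow, ← hx, pow_orderOf_eq_one, map_one]; exact Commute.one_left _)
      have hj5 : j ∣ 5 := by
        obtain ⟨i, hi, rfl⟩ := (Nat.dvd_prime_pow Nat.prime_five (m := 2)).1 hj25
        interval_cases i <;> lia
      obtain ⟨q, hq⟩ := hj5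
      rw [hq, pow_mul]
      exact hcomj.pow_left q
    rw [← hπ1]
    simp only [map_mul, map_inv, map_pow]
    rw [hcu.eq]
    group
  have hxC : x ^ 5 ∈ C := by
    have h1 := C.pow_index_mem (x ^ 5)
    have h2 : C.index = 1 ∨ C.index = 2 := by lia
    rcases h2 with h2 | h2
    · rwa [h2, pow_one] at h1
    · rw [h2] at h1
      have h3 := C.pow_mem h1 3
      rwa [← pow_mul, show 2 * 3 = 5 + 1 from rfl, pow_succ, hx55, one_mul] at h3
  have hcomm : ∀ u ∈ B, Commute (x ^ 5) u := by
    intro u hu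
    have h1 := hcom _ hxC u hu (hfix u hu) 5
    rw [hx55, one_mul, inv_one, mul_one, right_eq_mul] at h1
    have h2 : orderOf (x ^ 5 * u * (x ^ 5)⁻¹ * u⁻¹) ∣ 1 := by
      have h3 := (Subgroup.orderOf_dvd_natCard _ (hfix u hu)).trans hA
      have h4 := Nat.dvd_gcd (orderOf_dvd_of_pow_eq_one h1) h3
      simpa using h4
    rw [Nat.dvd_one, orderOf_eq_one_iff, mul_inv_eq_one, mul_inv_eq_iff_eq_mul] at h2
    exact h2
  exact hbc (commute_of_orderOf_eq_five hfree hV hx5 (hcomm b hb) (hcomm c hc)).eq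

theorem false_of_card_eq_seven_pow_four [Finite V] [Nontrivial V] [Finite H]
    [Group.IsSolvable H]
    (hfree : ∀ h v, v ≠ 0 → ρ h v = v → h = 1)
    (htrans : ∀ u v : V, u ≠ 0 → v ≠ 0 → ∃ h, ρ h u = v)
    (hV : Module.finrank (ZMod 7) V = 4) (hcard : Nat.card H = 2400)
    (hpoc : PerfectOrderClasses H) : False := by
  obtain ⟨A, hAn, hAc, hmax⟩ := exists_maximal_normal_commutative H
  obtain ⟨d, hd0, hd, hAd, hconj, hcent, -⟩ := normal_commutative_structure hfree htrans hAc
  obtain ⟨hidx, hall⟩ := centralizer_index_le_of_conj_eq_pow hconj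
  rw [hV] at hd hcent
  have hd4 : d = 1 ∨ d = 2 ∨ d = 4 := by
    have := Nat.le_of_dvd (by lia) hd
    interval_cases d <;> lia
  rcases hd4 with rfl | rfl | rfl
  · exact false_of_small_normal_commutative hfree hV hcard hAc hmax
      (hAd.trans (by norm_num)) (hidx.trans (by lia))
  · exact false_of_small_normal_commutative hfree hV hcard hAc hmax (by simpa using hAd) hidx
  · have hCA : Subgroup.centralizer (A : Set H) = A := by
      have hle : A ≤ Subgroup.centralizer (A : Set H) := fun a ha =>
        Subgroup.mem_centralizer_iff.2 fun b hb => hAc b hb a ha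
      refine le_antisymm (hmax _ inferInstance (fun a ha b hb => ?_) hle) hle
      exact hcent rfl a b (Subgroup.mem_centralizer_iff.1 ha) (Subgroup.mem_centralizer_iff.1 hb)
    have hcyc : IsCyclic A := isCyclic_of_normal_commutative hfree htrans hAc
    rw [hCA] at hidx hall
    have hidx0 : A.index ≠ 0 := Subgroup.index_ne_zero_of_finite
    have hmul : Nat.card A * A.index = 2400 := hcard ▸ Subgroup.card_mul_index A
    have htot : (Nat.card A).totient ∣ 2400 := hcard ▸ hpoc.totient_card_dvd A
    have h600 : A.index = 4 ∧ Nat.card A = 600 := by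
      have h1 : A.index = 1 ∨ A.index = 2 ∨ A.index = 3 ∨ A.index = 4 := by lia
      rcases h1 with h1 | h1 | h1 | h1
      · rw [show Nat.card A = 2 ^ 5 * (3 ^ 1 * 5 ^ 2) by lia, Nat.totient_mul (by norm_num),
          Nat.totient_mul (by norm_num), Nat.totient_prime_pow Nat.prime_two (by lia),
          Nat.totient_prime_pow Nat.prime_three (by lia),
          Nat.totient_prime_pow Nat.prime_five (by lia)] at htot
        norm_num at htot
      · rw [show Nat.card A = 2 ^ 4 * (3 ^ 1 * 5 ^ 2) by lia, Nat.totient_mul (by norm_num),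
          Nat.totient_mul (by norm_num), Nat.totient_prime_pow Nat.prime_two (by lia),
          Nat.totient_prime_pow Nat.prime_three (by lia),
          Nat.totient_prime_pow Nat.prime_five (by lia)] at htot
        norm_num at htot
      · rw [show Nat.card A = 2 ^ 5 * 5 ^ 2 by lia, Nat.totient_mul (by norm_num),
          Nat.totient_prime_pow Nat.prime_two (by lia),
          Nat.totient_prime_pow Nat.prime_five (by lia)] at htot
        norm_num at htot
      · exact ⟨h1, by lia⟩
    obtain ⟨h, hh⟩ := hall h600.1 1 (by lia)
    exact false_of_conj_eq_pow_seven h600.2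
      (fun s t hs hs1 ht ht1 => eq_of_sq_eq_one hfree hs hs1 ht ht1)
      (fun x hx => by rw [← hCA]; exact Subgroup.mem_centralizer_iff.2 hx) (by simpa using hh)

end FreeLinearAction

section FreeLinearAction

variable {V : Type*} [AddCommGroup V] {H : Type*} [Group H]

theorem exists_apply_eq_of_card_eq {p : ℕ} [Module (ZMod p) V]
    {ρ : H →* Module.End (ZMod p) V} [Finite V] [Finite H]
    (hfree : ∀ h v, v ≠ 0 → ρ h v = v → h = 1) (hVH : Nat.card V = Nat.card H + 1)
    (u v : V) (hu : u ≠ 0) (hv : v ≠ 0) : ∃ h, ρ h u = v := by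
  have hne : ∀ h, ρ h u ≠ 0 := fun h h0 => hu (by
    have : ρ h⁻¹ (ρ h u) = u := by
      rw [← Module.End.mul_apply, ← map_mul, inv_mul_cancel, map_one, Module.End.one_apply]
    rw [← this, h0, map_zero])
  let f : H → {w : V // w ≠ 0} := fun h => ⟨ρ h u, hne h⟩
  have hinj : Function.Injective f := fun a b hab => by
    have h1 : ρ a u = ρ b u := congrArg Subtype.val hab
    have h2 : ρ (b⁻¹ * a) u = u := by
      rw [map_mul, Module.End.mul_apply, h1, ← Module.End.mul_apply, ← map_mul, inv_mul_cancel,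
        map_one, Module.End.one_apply]
    exact (inv_mul_eq_one.1 (hfree _ u hu h2)).symm
  have hcard : Nat.card {w : V // w ≠ 0} = Nat.card H := by
    have := Set.ncard_add_ncard_compl ({0} : Set V)
    rw [Set.ncard_singleton, hVH, ← Nat.card_coe_set_eq] at this
    change 1 + Nat.card {w : V // w ≠ 0} = _ at this
    lia
  obtain ⟨h, hh⟩ := ((Nat.bijective_iff_injective_and_card f).2 ⟨hinj, hcard.symm⟩).2 ⟨v, hv⟩
  exact ⟨h, congrArg Subtype.val hh⟩

theorem false_of_card_eq_add_one {p : ℕ} [Fact p.Prime] [Module (ZMod p) V]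
    {ρ : H →* Module.End (ZMod p) V} [Finite V] [Finite H] [Group.IsSolvable H]
    (hfree : ∀ h v, v ≠ 0 → ρ h v = v → h = 1) (hVH : Nat.card V = Nat.card H + 1)
    (hnil : ¬ Group.IsNilpotent H)
    (hsm : ∀ r : ℕ, r.Prime → r ∣ Nat.card H → r = 2 ∨ r = 3 ∨ r = 5)
    (h2 : 2 ∣ Nat.card H) (h3 : 3 ∣ Nat.card H) (h5 : 5 ∣ Nat.card H)
    (hpoc : PerfectOrderClasses H) : False := by
  have htrans := exists_apply_eq_of_card_eq hfree hVH
  have hHpos : 0 < Nat.card H := Nat.card_pos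
  have hnt : Nontrivial V := Finite.one_lt_card_iff_nontrivial.1 (by lia)
  have hpow : Nat.card V = p ^ Module.finrank (ZMod p) V := by
    rw [Module.natCard_eq_pow_finrank (K := ZMod p), Nat.card_zmod]
  have hcard : Nat.card H = p ^ Module.finrank (ZMod p) V - 1 := by lia
  have hnc : ¬ ∀ a b : H, a * b = b * a := fun h => by
    let _ : CommGroup H := { ‹Group H› with mul_comm := h }
    exact hnil CommGroup.isNilpotent
  have hcen : Subgroup.center H ≠ ⊤ := fun h => hnc fun a b => by
    have : b ∈ Subgroup.center H := h ▸ Subgroup.mem_top b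
    exact Subgroup.mem_center_iff.1 this a
  rcases smooth_prime_pow_sub_one (Fact.out : p.Prime) Module.finrank_pos (hcard ▸ h2)
    (hcard ▸ h3) (hcard ▸ hsm) with h | h | ⟨rfl, h⟩
  · obtain ⟨v, hv⟩ := exists_ne (0 : V)
    refine hnc fun a b => (commute_of_span_pow_eq_top (ρ := ρ) hfree (x := 1) (v := v) ?_
      (Commute.one_left a) (Commute.one_left b)).eq
    simpa using (finrank_eq_one_iff_of_nonzero v hv).1 h
  · exact false_of_finrank_eq_two hfree htrans h (h ▸ hcard) hsm h2 h3 h5 hcen hpoc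
  · rw [h] at hcard
    exact false_of_card_eq_seven_pow_four hfree htrans h (by simpa using hcard) hpoc

end FreeLinearAction

theorem false_of_mulAut {p : ℕ} [Fact p.Prime] {T H : Type*} [CommGroup T] [Finite T] [Group H]
    [Finite H] [Group.IsSolvable H] (φ : H →* MulAut T) (hT : ∀ t : T, t ^ p = 1)
    (hfree : ∀ h t, t ≠ 1 → φ h t = t → h = 1) (hTH : Nat.card T = Nat.card H + 1)
    (hnil : ¬ Group.IsNilpotent H)
    (hsm : ∀ r : ℕ, r.Prime → r ∣ Nat.card H → r = 2 ∨ r = 3 ∨ r = 5)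
    (h2 : 2 ∣ Nat.card H) (h3 : 3 ∣ Nat.card H) (h5 : 5 ∣ Nat.card H)
    (hpoc : PerfectOrderClasses H) : False := by
  let _ : Module (ZMod p) (Additive T) := AddCommGroup.zmodModule (n := p) fun x => hT x.toMul
  let ρ : H →* Module.End (ZMod p) (Additive T) :=
    { toFun := fun h => AddMonoidHom.toZModLinearMap p (MonoidHom.toAdditive (φ h).toMonoidHom)
      map_one' := LinearMap.ext fun x => by simp
      map_mul' := fun a b => LinearMap.ext fun x => by simp }
  exact false_of_card_eq_add_one (ρ := ρ) (fun h v hv hhv => hfree h v.toMul hv hhv) hTH hnil hsm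
    h2 h3 h5 hpoc

namespace IsFrobeniusWith

variable {G : Type*} [Group G] {K H : Subgroup G}

theorem card_mul_card (hF : IsFrobeniusWith K H) : Nat.card K * Nat.card H = Nat.card G := by
  obtain ⟨-, -, -, hinf, hprod, -⟩ := hF
  refine (Subgroup.isComplement'_of_disjoint_and_mul_eq_univ (disjoint_iff.2 hinf) ?_).card_mul_card
  refine Set.eq_univ_of_forall fun g => ?_
  obtain ⟨k, hk, h, hh, rfl⟩ := hprod g
  exact Set.mul_mem_mul hk hh

/-- The complement acts semiregularly on the nontrivial elements of the kernel. -/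
theorem card_dvd_card_of_invariant (hF : IsFrobeniusWith K H) {S : Set G}
    (hS : ∀ s ∈ S, s ∈ K ∧ s ≠ 1) (hconj : ∀ h ∈ H, ∀ s ∈ S, h * s * h⁻¹ ∈ S) :
    Nat.card H ∣ Nat.card S := by
  obtain ⟨-, -, -, -, -, hfpf⟩ := hF
  let _ : MulAction H S :=
    { smul := fun h s => ⟨h * s * (h : G)⁻¹, hconj h h.2 s s.2⟩
      one_smul := fun s => Subtype.ext <| by
        change ((1 : H) : G) * s * ((1 : H) : G)⁻¹ = s
        simp
      mul_smul := fun a b s => Subtype.ext <| by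
        change ((a * b : H) : G) * s * ((a * b : H) : G)⁻¹ =
          (a : G) * ((b : G) * s * (b : G)⁻¹) * (a : G)⁻¹
        simp [mul_assoc] }
  refine card_dvd_card_of_free fun h s hs => ?_
  by_contra h1
  exact hfpf h h.2 (fun h0 => h1 (Subtype.ext h0)) s (hS s s.2).1 (hS s s.2).2
    (congrArg Subtype.val hs)

theorem coprime_card [Finite G] (hF : IsFrobeniusWith K H) :
    (Nat.card K).Coprime (Nat.card H) := by
  have hdvd : Nat.card H ∣ Nat.card ((K : Set G) \ {1} : Set G) := by
    refine hF.card_dvd_card_of_invariant (fun s hs => hs) fun h _ s hs =>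
      ⟨hF.2.2.1.conj_mem s hs.1 h, fun h1 => hs.2 ?_⟩
    simpa using h1
  rw [Nat.card_coe_set_eq, Set.ncard_sdiff_singleton_of_mem K.one_mem, ← Nat.card_coe_set_eq]
    at hdvd
  have hpos : 0 < Nat.card K := Nat.card_pos
  change Nat.card H ∣ Nat.card K - 1 at hdvd
  refine Nat.Coprime.coprime_dvd_right hdvd ?_
  have := Nat.coprime_self_add_right (m := Nat.card K - 1) (n := 1)
  rw [Nat.coprime_comm]
  simpa [Nat.sub_add_cancel hpos] using this

theorem exists_conj_eq_mul [Finite G] (hF : IsFrobeniusWith K H) {h : G} (hh : h ∈ H)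
    (h1 : h ≠ 1) {k : G} (hk : k ∈ K) : ∃ c : G, c * h * c⁻¹ = k * h := by
  obtain ⟨-, -, hK, -, -, hfpf⟩ := hF
  let φ : K →* K := (MulAut.conjNormal h : MulAut K).toMonoidHom
  have hφ : ∀ x : K, (φ x : G) = h * x * h⁻¹ := fun x => MulAut.conjNormal_apply h x
  have hfp : MonoidHom.FixedPointFree φ := fun x hx => by
    by_contra hx1
    refine hfpf h hh h1 x x.2 (fun h0 => hx1 (Subtype.ext h0)) ?_
    rw [← hφ, hx]
  obtain ⟨c, hc⟩ := hfp.commutatorMap_surjective ⟨k, hk⟩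
  refine ⟨c, ?_⟩
  have h2 : (c : G) / φ c = k := by
    rw [← Subgroup.coe_div]
    exact congrArg Subtype.val hc
  rw [← h2, hφ, div_eq_mul_inv]
  group

theorem orderOf_mul [Finite G] (hF : IsFrobeniusWith K H) {h : G} (hh : h ∈ H)
    (h1 : h ≠ 1) {k : G} (hk : k ∈ K) : orderOf (k * h) = orderOf h := by
  obtain ⟨c, hc⟩ := hF.exists_conj_eq_mul hh h1 hk
  rw [← hc, ← MulAut.conj_apply, MulEquiv.orderOf_eq]

theorem mem_of_coprime_orderOf [Finite G] (hF : IsFrobeniusWith K H) {g : G}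
    (hg : (orderOf g).Coprime (Nat.card H)) : g ∈ K := by
  obtain ⟨k, hk, h, hh, rfl⟩ := hF.2.2.2.2.1 g
  by_cases h1 : h = 1
  · rwa [h1, mul_one]
  rw [hF.orderOf_mul hh h1 hk] at hg
  exact absurd (orderOf_eq_one_iff.1
    (Nat.eq_one_of_dvd_coprimes hg dvd_rfl (H.orderOf_dvd_natCard hh))) h1

theorem orderCount_eq [Finite G] (hF : IsFrobeniusWith K H) {n : ℕ} (hn1 : n ≠ 1)
    (hn : n ∣ Nat.card H) : orderCount G n = Nat.card K * orderCount H n := by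
  have hone : ∀ h : H, orderOf h = n → (h : G) ≠ 1 := fun h hh h0 => hn1 (by
    rw [← hh, ← Subgroup.orderOf_coe, h0, orderOf_one])
  let f : K × {h : H // orderOf h = n} → {g : G // orderOf g = n} := fun x =>
    ⟨x.1 * x.2.1, by
      rw [hF.orderOf_mul x.2.1.2 (hone _ x.2.2) x.1.2, Subgroup.orderOf_coe, x.2.2]⟩
  have hf : Function.Bijective f := by
    constructor
    · rintro ⟨⟨k, hk⟩, ⟨⟨h, hh⟩, ho⟩⟩ ⟨⟨k', hk'⟩, ⟨⟨h', hh'⟩, ho'⟩⟩ heq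
      have h1 : k * h = k' * h' := congrArg Subtype.val heq
      have h2 : k'⁻¹ * k = h' * h⁻¹ := by
        rw [eq_mul_inv_iff_mul_eq, mul_assoc, h1, inv_mul_cancel_left]
      have h3 : k'⁻¹ * k ∈ K ⊓ H :=
        ⟨K.mul_mem (K.inv_mem hk') hk, h2 ▸ H.mul_mem hh' (H.inv_mem hh)⟩
      rw [hF.2.2.2.1, Subgroup.mem_bot, inv_mul_eq_one] at h3
      subst h3
      obtain rfl := mul_left_cancel h1
      rfl
    · rintro ⟨g, hg⟩
      obtain ⟨k, hk, h, hh, rfl⟩ := hF.2.2.2.2.1 g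
      have h1 : h ≠ 1 := by
        rintro rfl
        rw [mul_one] at hg
        have := K.orderOf_dvd_natCard hk
        rw [hg] at this
        exact hn1 (Nat.eq_one_of_dvd_coprimes hF.coprime_card this hn)
      refine ⟨⟨⟨k, hk⟩, ⟨⟨h, hh⟩, ?_⟩⟩, rfl⟩
      rw [← hg, hF.orderOf_mul hh h1 hk, Subgroup.orderOf_mk]
  rw [orderCount, orderCount, ← Nat.card_prod, Nat.card_congr (Equiv.ofBijective f hf)]

/-- Frobenius complements inherit perfect order classes. -/
theorem perfectOrderClasses_complement [Finite G] (hF : IsFrobeniusWith K H)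
    (hpoc : PerfectOrderClasses G) : PerfectOrderClasses H := by
  intro n hn
  rw [or_iff_not_imp_left]
  intro h0
  have hne : Nonempty {h : H // orderOf h = n} := (Nat.card_ne_zero.1 h0).1
  obtain ⟨h, hh⟩ := hne
  have hdvd : n ∣ Nat.card H := hh ▸ orderOf_dvd_natCard h
  by_cases hn1 : n = 1
  · subst hn1
    have : orderCount H 1 = 1 := by simp [orderCount]
    rw [this]
    exact one_dvd _
  have hpos : 0 < Nat.card K := Nat.card_pos
  have h1 := hF.orderCount_eq hn1 hdvd
  rcases hpoc n hn with h2 | h2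
  · rw [h1] at h2
    exact absurd (Nat.mul_eq_zero.1 h2) (by simp [hpos.ne', h0])
  · rw [h1, ← hF.card_mul_card] at h2
    exact Nat.dvd_of_mul_dvd_mul_left hpos h2

theorem commute_of_even [Finite G] (hF : IsFrobeniusWith K H) (h2 : 2 ∣ Nat.card H) {a b : G}
    (ha : a ∈ K) (hb : b ∈ K) : a * b = b * a := by
  have : Fact (Nat.Prime 2) := ⟨Nat.prime_two⟩
  obtain ⟨-, -, hK, -, -, hfpf⟩ := hF
  obtain ⟨t, ht⟩ := exists_prime_orderOf_dvd_card' 2 h2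
  have ht1 : (t : G) ≠ 1 := fun h => by
    rw [← Subgroup.orderOf_coe, h, orderOf_one] at ht
    lia
  have ht2 : (t : G) * t = 1 := by
    rw [← sq, ← ht, ← Subgroup.coe_pow, pow_orderOf_eq_one, Subgroup.coe_one]
  let φ : K →* K := (MulAut.conjNormal (t : G) : MulAut K).toMonoidHom
  have hφ : ∀ x : K, (φ x : G) = t * x * (t : G)⁻¹ := fun x => MulAut.conjNormal_apply _ x
  have hfp : MonoidHom.FixedPointFree φ := fun x hx => by
    by_contra hx1
    refine hfpf t t.2 ht1 x x.2 (fun h0 => hx1 (Subtype.ext h0)) ?_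
    rw [← hφ, hx]
  have hinv : Function.Involutive φ := fun x => Subtype.ext <| by
    have h3 : (t : G)⁻¹ = t := inv_eq_of_mul_eq_one_left ht2
    rw [hφ, hφ, h3, ← mul_assoc, ← mul_assoc, ht2, one_mul, mul_assoc, ht2, mul_one]
  exact congrArg Subtype.val (hfp.commute_all_of_involutive hinv ⟨a, ha⟩ ⟨b, hb⟩).eq

theorem card_dvd_orderCount [Finite G] (hF : IsFrobeniusWith K H) {p : ℕ} (hp : p.Prime)
    (hpK : p ∣ Nat.card K) : Nat.card H ∣ orderCount G p := by
  refine hF.card_dvd_card_of_invariant (S := {g | orderOf g = p}) (fun s hs => ⟨?_, ?_⟩) ?_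
  · refine hF.mem_of_coprime_orderOf ?_
    rw [show orderOf s = p from hs]
    exact Nat.Coprime.coprime_dvd_left hpK hF.coprime_card
  · rintro rfl
    exact hp.one_lt.ne (orderOf_one.symm.trans hs)
  · intro h _ s hs
    rw [Set.mem_ofPred_eq, ← MulAut.conj_apply, MulEquiv.orderOf_eq]
    exact hs

theorem prime_unique [Finite G] (hF : IsFrobeniusWith K H) (hpoc : PerfectOrderClasses G)
    (hcomm : ∀ a ∈ K, ∀ b ∈ K, a * b = b * a) (hH : Nat.card H ≠ 1) {p q : ℕ} (hp : p.Prime)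
    (hq : q.Prime) (hpK : p ∣ Nat.card K) (hqK : q ∣ Nat.card K) : q = p := by
  by_contra hpq
  have hmemK : ∀ {r : ℕ}, r ∣ Nat.card K → ∀ {g : G}, orderOf g = r → g ∈ K := fun hr g hg =>
    hF.mem_of_coprime_orderOf (hg ▸ Nat.Coprime.coprime_dvd_left hr hF.coprime_card)
  have hprod : orderCount G (p * q) = orderCount G p * orderCount G q := by
    rw [orderCount_mul_of_coprime G hp.pos hq.pos ((Nat.coprime_primes hp hq).2 (Ne.symm hpq)),
      orderCount, orderCount, ← Nat.card_prod]
    exact Nat.card_congr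
      { toFun := fun x => ⟨⟨x.1.1, x.2.1⟩, ⟨x.1.2, x.2.2.1⟩⟩
        invFun := fun x => ⟨⟨x.1.1, x.2.1⟩, x.1.2, x.2.2,
          hcomm _ (hmemK hpK x.1.2) _ (hmemK hqK x.2.2)⟩
        left_inv := fun _ => rfl
        right_inv := fun _ => rfl }
  have hpos : ∀ {r : ℕ}, r.Prime → r ∣ Nat.card K → orderCount G r ≠ 0 := fun {r} hr hrK => by
    have : Fact r.Prime := ⟨hr⟩
    obtain ⟨g, hg⟩ := exists_prime_orderOf_dvd_card' r (hrK.trans K.card_subgroup_dvd_card)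
    have : Nonempty {g : G // orderOf g = r} := ⟨⟨g, hg⟩⟩
    exact Nat.card_pos.ne'
  have hdvd := (hpoc (p * q) (Nat.mul_pos hp.pos hq.pos)).resolve_left (by
    rw [hprod]; exact Nat.mul_ne_zero (hpos hp hpK) (hpos hq hqK))
  rw [hprod, ← hF.card_mul_card] at hdvd
  have h1 := (mul_dvd_mul (hF.card_dvd_orderCount hp hpK) (hF.card_dvd_orderCount hq hqK)).trans
    hdvd
  exact hH (Nat.eq_one_of_dvd_coprimes hF.coprime_card
    (Nat.dvd_of_mul_dvd_mul_right Nat.card_pos h1) dvd_rfl)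

/-- The complement acts regularly on the elements of prime order of the kernel, which together
with the identity form an elementary abelian normal subgroup. -/
theorem exists_elementary_subgroup [Finite G] (hF : IsFrobeniusWith K H)
    (hpoc : PerfectOrderClasses G) (hcomm : ∀ a ∈ K, ∀ b ∈ K, a * b = b * a)
    (hH : Nat.card H ≠ 1) :
    ∃ (p : ℕ) (T : Subgroup G), p.Prime ∧ T.Normal ∧ T ≤ K ∧ (∀ t ∈ T, t ^ p = 1) ∧
      Nat.card T = Nat.card H + 1 := by
  have hK1 : Nat.card K ≠ 1 := fun h => hF.1 (K.eq_bot_of_card_eq h)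
  obtain ⟨p, hp, hpK⟩ := Nat.exists_prime_and_dvd hK1
  have : Fact p.Prime := ⟨hp⟩
  let T : Subgroup G :=
    { carrier := {g | g ∈ K ∧ g ^ p = 1}
      one_mem' := ⟨K.one_mem, one_pow p⟩
      mul_mem' := fun {a b} ha hb => ⟨K.mul_mem ha.1 hb.1, by
        have : Commute a b := hcomm a ha.1 b hb.1
        rw [this.mul_pow, ha.2, hb.2, one_mul]⟩
      inv_mem' := fun {a} ha => ⟨K.inv_mem ha.1, by rw [inv_pow, ha.2, inv_one]⟩ }
  have hT : ∀ g, g ∈ T ↔ g ∈ K ∧ g ^ p = 1 := fun g => Iff.rfl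
  refine ⟨p, T, hp, ⟨fun t ht g => ⟨hF.2.2.1.conj_mem t ht.1 g, ?_⟩⟩, fun t ht => ht.1,
    fun t ht => ht.2, ?_⟩
  · rw [conj_pow, ht.2, mul_one, mul_inv_cancel]
  have hset : {g : G | orderOf g = p} = (T : Set G) \ {1} := by
    ext g
    rw [Set.mem_ofPred_eq, orderOf_eq_prime_iff, Set.mem_sdiff, SetLike.mem_coe, hT,
      Set.mem_singleton_iff]
    refine ⟨fun h => ⟨⟨hF.mem_of_coprime_orderOf ?_, h.1⟩, h.2⟩, fun h => ⟨h.1.2, h.2⟩⟩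
    rw [orderOf_eq_prime h.1 h.2]
    exact Nat.Coprime.coprime_dvd_left hpK hF.coprime_card
  have hcount : orderCount G p + 1 = Nat.card T := by
    have h1 : orderCount G p = ((T : Set G) \ {1}).ncard := by
      rw [← hset, ← Nat.card_coe_set_eq]; rfl
    rw [h1, Set.ncard_sdiff_singleton_add_one T.one_mem]
    rfl
  obtain ⟨t, ht⟩ := exists_prime_orderOf_dvd_card' p (hpK.trans K.card_subgroup_dvd_card)
  have hN0 : orderCount G p ≠ 0 := by
    have : Nonempty {g : G // orderOf g = p} := ⟨⟨t, ht⟩⟩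
    exact Nat.card_pos.ne'
  have hpT : p ∣ Nat.card T := by
    have : t ∈ (T : Set G) \ {1} := hset ▸ ht
    exact ht ▸ T.orderOf_dvd_natCard this.1
  have hcop : (orderCount G p).Coprime p := by
    refine Nat.Coprime.coprime_dvd_right hpT ?_
    rw [← hcount]
    simp
  obtain ⟨n, hn⟩ : ∃ n, Nat.card K = p ^ n :=
    ⟨_, Nat.eq_prime_pow_of_unique_prime_dvd Nat.card_pos.ne' fun hq hqK =>
      hF.prime_unique hpoc hcomm hH hp hq hpK hqK⟩
  have hdvd := (hpoc p hp.pos).resolve_left hN0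
  rw [← hF.card_mul_card, hn] at hdvd
  rw [← hcount, Nat.dvd_antisymm ((hcop.pow_right n).dvd_of_dvd_mul_left hdvd)
    (hF.card_dvd_orderCount hp hpK)]

end IsFrobeniusWith

/-- There is no finite Frobenius group with perfect order classes whose Frobenius complement
is soluble, not nilpotent, a `{2,3,5}`-group, and of order divisible by both 3 and 5. -/
theorem no_frobenius_perfectOrderClasses_soluble_235_complement
    {G : Type*} [Group G] [Fintype G] (K H : Subgroup G)
    (hFrob : IsFrobeniusWith K H)
    (hsol : IsSolvable H) (hnotnil : ¬ Group.IsNilpotent H)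
    (hdiv : ∀ p : ℕ, p.Prime → p ∣ Nat.card H → p = 2 ∨ p = 3 ∨ p = 5)
    (h3 : 3 ∣ Nat.card H) (h5 : 5 ∣ Nat.card H) :
    ¬ PerfectOrderClasses G := by
  intro hpoc
  have hpocH := hFrob.perfectOrderClasses_complement hpoc
  have h2 : 2 ∣ Nat.card H := by
    have : Fact (Nat.Prime 3) := ⟨Nat.prime_three⟩
    obtain ⟨x, hx⟩ := exists_prime_orderOf_dvd_card' 3 h3
    have := hpocH.totient_dvd x
    rwa [hx, Nat.totient_prime Nat.prime_three] at this
  have hcomm : ∀ a ∈ K, ∀ b ∈ K, a * b = b * a := fun a ha b hb =>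
    hFrob.commute_of_even h2 ha hb
  obtain ⟨p, T, hp, hTn, hTK, hTp, hcard⟩ :=
    hFrob.exists_elementary_subgroup hpoc hcomm (fun h => by lia)
  have : Fact p.Prime := ⟨hp⟩
  have : Group.IsSolvable H := hsol
  let _ : CommGroup T :=
    { (inferInstance : Group T) with
      mul_comm := fun a b => Subtype.ext (hcomm a (hTK a.2) b (hTK b.2)) }
  refine false_of_mulAut (T := T) ((MulAut.conjNormal (H := T)).comp H.subtype)
    (fun t => Subtype.ext (hTp t t.2)) (fun h t ht hht => ?_) hcard hnotnil hdiv h2 h3 h5 hpocH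
  by_contra h1
  refine hFrob.2.2.2.2.2 h h.2 (fun h0 => h1 (Subtype.ext h0)) t (hTK t.2)
    (fun h0 => ht (Subtype.ext h0)) ?_
  exact (MulAut.conjNormal_apply (h : G) t).symm.trans (congrArg Subtype.val hht)
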